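/- arXiv:1910.09653 — 15 statements merged into one kernel-verified Lean document; each statement's English description precedes it below -/
import Mathlib

section
/- Let K be a field with char(K) ≠ 2, let f = X² + a₁X + a₂ be an irreducible polynomial over K, let α be a root of f, and let L = K(α). Then an element β ∈ L lies in T₀·T₀ if and only if β ∈ K. -/
open Polynomial

/-- If `α` is a root of a monic quadratic over `K`, then every element of `K[α]` is of the form
`c + d α` with `c, d ∈ K`. -/
lemma exists_eq_add_mul_of_mem_adjoin {K L : Type*} [CommRing K] [CommRing L] [Algebra K L]
    {a₁ a₂ : K} {α : L}
    (hα : α ^ 2 + algebraMap K L a₁ * α + algebraMap K L a₂ = 0) {x : L}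
    (hx : x ∈ Algebra.adjoin K {α}) :
    ∃ c d : K, x = algebraMap K L c + algebraMap K L d * α := by
  induction hx using Algebra.adjoin_induction with
  | mem x hx => exact ⟨0, 1, by simpa using hx⟩
  | algebraMap r => exact ⟨r, 0, by simp⟩
  | add x y _ _ hx hy =>
    obtain ⟨c, d, rfl⟩ := hx
    obtain ⟨e, f, rfl⟩ := hy
    exact ⟨c + e, d + f, by simp only [map_add]; ring⟩
  | mul x y _ _ hx hy =>
    obtain ⟨c, d, rfl⟩ := hx
    obtain ⟨e, f, rfl⟩ := hy
    refine ⟨c * e - d * f * a₂, c * f + d * e - d * f * a₁, ?_⟩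
    simp only [map_add, map_sub, map_mul]
    linear_combination algebraMap K L d * algebraMap K L f * hα

/-- For a quadratic extension L = K(α), char K ≠ 2, with α a root of the irreducible
polynomial X² + a₁X + a₂ over K: β ∈ T₀·T₀ iff β ∈ K. -/
theorem stmt_1 (K L : Type*) [Field K] [Field L] [Algebra K L] [FiniteDimensional K L]
    (hchar : ringChar K ≠ 2) (a₁ a₂ : K)
    (hirr : Irreducible (X ^ 2 + C a₁ * X + C a₂ : K[X]))
    (α : L) (hroot : Polynomial.aeval α (X ^ 2 + C a₁ * X + C a₂ : K[X]) = 0)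
    (hgen : Algebra.adjoin K {α} = ⊤) (β : L) :
    (∃ x y : L, Algebra.trace K L x = 0 ∧ Algebra.trace K L y = 0 ∧ β = x * y) ↔
      β ∈ (algebraMap K L).range := by
  have h2 : (2 : K) ≠ 0 := Ring.two_ne_zero hchar
  have hdeg : (X ^ 2 + C a₁ * X + C a₂ : K[X]).natDegree = 2 := by compute_degree!
  have hmonic : (X ^ 2 + C a₁ * X + C a₂ : K[X]).Monic := by monicity!
  have hmin := minpoly.eq_of_irreducible_of_monic hirr hroot hmonic
  have hα : α ^ 2 + algebraMap K L a₁ * α + algebraMap K L a₂ = 0 := by simpa using hroot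
  let pb := PowerBasis.ofAdjoinEqTop (Algebra.IsIntegral.isIntegral α) hgen
  have hgen_eq : pb.gen = α := PowerBasis.ofAdjoinEqTop_gen _ _
  have hrank : Module.finrank K L = 2 := by
    rw [pb.finrank, ← pb.natDegree_minpoly, hgen_eq, ← hmin, hdeg]
  have htrα : Algebra.trace K L α = -a₁ := by
    have h := pb.trace_gen_eq_nextCoeff_minpoly
    rw [hgen_eq, ← hmin, nextCoeff_of_natDegree_pos (by omega), hdeg] at h
    simpa [coeff_X, coeff_C] using h
  have htr (c d : K) : Algebra.trace K L (algebraMap K L c + algebraMap K L d * α)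
      = 2 * c - d * a₁ := by
    rw [map_add, Algebra.trace_algebraMap, hrank, ← Algebra.smul_def, map_smul, htrα]
    simp [sub_eq_add_neg]
  have hδ : (algebraMap K L a₁ + algebraMap K L 2 * α) ^ 2
      = algebraMap K L (a₁ ^ 2 - 4 * a₂) := by
    simp only [map_sub, map_mul, map_pow, map_ofNat]
    linear_combination 4 * hα
  have hker (x : L) (hx : Algebra.trace K L x = 0) :
      ∃ e : K, x = algebraMap K L e * (algebraMap K L a₁ + algebraMap K L 2 * α) := by
    obtain ⟨c, d, rfl⟩ := exists_eq_add_mul_of_mem_adjoin hα (hgen ▸ Algebra.mem_top : x ∈ _)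
    rw [htr] at hx
    have hc : c = d / 2 * a₁ := by field_simp; linear_combination hx
    have hd : d = d / 2 * 2 := by field_simp
    refine ⟨d / 2, ?_⟩
    rw [mul_add, ← mul_assoc, ← map_mul, ← map_mul, ← hc, ← hd]
  constructor
  · rintro ⟨x, y, hx, hy, rfl⟩
    obtain ⟨e, rfl⟩ := hker x hx
    obtain ⟨f, rfl⟩ := hker y hy
    refine ⟨e * f * (a₁ ^ 2 - 4 * a₂), ?_⟩
    rw [map_mul, ← hδ, map_mul]
    ring
  · rintro ⟨k, rfl⟩
    have hD : a₁ ^ 2 - 4 * a₂ ≠ 0 := by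
      intro hD
      rw [hD, map_zero, sq_eq_zero_iff] at hδ
      have hα' : α = algebraMap K L (-a₁ / 2) := by
        have h2' : (2 : L) ≠ 0 := by
          rw [← map_ofNat (algebraMap K L) 2]
          exact (_root_.map_ne_zero _).mpr h2
        simp only [map_div₀, map_neg, map_ofNat] at hδ ⊢
        field_simp
        linear_combination hδ
      have h := congrArg natDegree hmin
      rw [hdeg, hα', minpoly.eq_X_sub_C, natDegree_X_sub_C] at h
      omega
    have htrδ : Algebra.trace K L (algebraMap K L a₁ + algebraMap K L 2 * α) = 0 := by
      rw [htr, sub_self]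
    refine ⟨algebraMap K L (k / (a₁ ^ 2 - 4 * a₂)) * (algebraMap K L a₁ + algebraMap K L 2 * α),
      _, ?_, htrδ, ?_⟩
    · rw [← Algebra.smul_def, map_smul, htrδ, smul_zero]
    · rw [mul_assoc, ← sq, hδ, ← map_mul, div_mul_cancel₀ _ hD]
end

section
/- Let K be a field with char(K) ≠ 2, let f = X² + a₁X + a₂ be an irreducible polynomial over K, let α be a root of f, and let L = K(α). Then an element β ∈ L lies in T₀·T₁ if and only if β ∉ K \ {0}, i.e. if and only if β = 0 or β ∉ K. -/
open Polynomial

/-- If every element of `L` is `p + q δ` with `p, q ∈ K`, where `δ ∉ K`, `δ² ∈ K` and the trace of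
`p + q δ` is `2 p`, then the products of a trace-zero and a trace-one element are exactly `0` and
the elements outside `K`. -/
theorem exists_trace_zero_mul_trace_one_iff {K L : Type*} [Field K] [Field L] [Algebra K L]
    (h2 : (2 : K) ≠ 0) {δ : L} {d : K} (hδ : δ ∉ (algebraMap K L).range)
    (hsq : δ ^ 2 = algebraMap K L d)
    (hrep : ∀ x : L, ∃ p q : K, x = algebraMap K L p + algebraMap K L q * δ)
    (htr : ∀ p q : K, Algebra.trace K L (algebraMap K L p + algebraMap K L q * δ) = 2 * p)
    (β : L) :
    (∃ x y : L, Algebra.trace K L x = 0 ∧ Algebra.trace K L y = 1 ∧ β = x * y) ↔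
      (β = 0 ∨ β ∉ (algebraMap K L).range) := by
  have hd : d ≠ 0 := by
    rintro rfl
    rw [map_zero, sq_eq_zero_iff] at hsq
    exact hδ (hsq ▸ zero_mem _)
  have h2L : (2 : L) ≠ 0 := by
    simpa only [_root_.map_ofNat] using (_root_.map_ne_zero (algebraMap K L)).2 h2
  constructor
  · rintro ⟨x, y, hx, hy, rfl⟩
    obtain ⟨p, s, rfl⟩ := hrep x
    obtain ⟨r, t, rfl⟩ := hrep y
    rw [htr] at hx hy
    obtain rfl : p = 0 := (mul_eq_zero.1 hx).resolve_left h2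
    by_cases hs : s = 0
    · simp [hs]
    right
    rintro ⟨k, hk⟩
    refine hδ ⟨2 * (k - s * t * d) / s, ?_⟩
    have hsL : algebraMap K L s ≠ 0 := (_root_.map_ne_zero _).2 hs
    have hyL : 2 * algebraMap K L r = 1 := by
      simpa only [map_mul, _root_.map_ofNat, map_one] using congrArg (algebraMap K L) hy
    simp only [map_div₀, map_mul, map_sub, map_ofNat, map_zero, ← hsq] at hk ⊢
    rw [hk, div_eq_iff hsL]
    linear_combination (algebraMap K L s * δ) * hyL
  · intro h
    obtain ⟨u, v, rfl⟩ := hrep β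
    by_cases hv : v = 0
    · have h0 : algebraMap K L u + algebraMap K L v * δ = 0 :=
        h.resolve_right fun h => h ⟨u, by simp [hv]⟩
      refine ⟨0, algebraMap K L (1 / 2) + algebraMap K L 0 * δ, map_zero _, ?_,
        by rw [h0, zero_mul]⟩
      rw [htr]
      field_simp
    · refine ⟨algebraMap K L 0 + algebraMap K L (2 * v) * δ,
        algebraMap K L (1 / 2) + algebraMap K L (u / (2 * v * d)) * δ, ?_, ?_, ?_⟩
      · rw [htr, mul_zero]
      · rw [htr]
        field_simp
      · have hvL : algebraMap K L v ≠ 0 := (_root_.map_ne_zero _).2 hv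
        have hdL : algebraMap K L d ≠ 0 := (_root_.map_ne_zero _).2 hd
        simp only [map_div₀, map_mul, map_ofNat, map_zero, map_one]
        field_simp
        linear_combination (-2 * algebraMap K L v * algebraMap K L u) * hsq

/-- For a quadratic extension L = K(α), char K ≠ 2, with α a root of the irreducible
polynomial X² + a₁X + a₂ over K: β ∈ T₀·T₁ iff β = 0 or β ∉ K. -/
theorem stmt_2 (K L : Type*) [Field K] [Field L] [Algebra K L] [FiniteDimensional K L]
    (hchar : ringChar K ≠ 2) (a₁ a₂ : K)
    (hirr : Irreducible (X ^ 2 + C a₁ * X + C a₂ : K[X]))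
    (α : L) (hroot : Polynomial.aeval α (X ^ 2 + C a₁ * X + C a₂ : K[X]) = 0)
    (hgen : Algebra.adjoin K {α} = ⊤) (β : L) :
    (∃ x y : L, Algebra.trace K L x = 0 ∧ Algebra.trace K L y = 1 ∧ β = x * y) ↔
      (β = 0 ∨ β ∉ (algebraMap K L).range) := by
  have h2 : (2 : K) ≠ 0 := Ring.two_ne_zero hchar
  have h2L : (2 : L) ≠ 0 := by
    simpa only [_root_.map_ofNat] using (_root_.map_ne_zero (algebraMap K L)).2 h2
  have hdeg : (X ^ 2 + C a₁ * X + C a₂ : K[X]).natDegree = 2 := by compute_degree!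
  have hmin : X ^ 2 + C a₁ * X + C a₂ = minpoly K α :=
    minpoly.eq_of_irreducible_of_monic hirr hroot (by monicity!)
  have hαint : IsIntegral K α := IsIntegral.of_finite K α
  have hfin : Module.finrank K L = 2 := by
    rw [(PowerBasis.ofAdjoinEqTop hαint hgen).finrank, PowerBasis.ofAdjoinEqTop_dim, ← hmin, hdeg]
  have htrα : Algebra.trace K L α = -a₁ := by
    have h := (PowerBasis.ofAdjoinEqTop hαint hgen).trace_gen_eq_nextCoeff_minpoly
    rw [PowerBasis.ofAdjoinEqTop_gen, ← hmin, nextCoeff_of_natDegree_pos (by omega), hdeg] at h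
    simpa [coeff_X_pow, coeff_C] using h
  have hα : α ∉ (algebraMap K L).range := by
    rintro ⟨k, rfl⟩
    rw [minpoly.eq_X_sub_C] at hmin
    rw [hmin, natDegree_X_sub_C] at hdeg
    omega
  have hα2 : α ^ 2 + algebraMap K L a₁ * α + algebraMap K L a₂ = 0 := by simpa using hroot
  have hrep : ∀ x : L, ∃ p q : K, x = algebraMap K L p + algebraMap K L q * α := by
    intro x
    have hx : x ∈ Algebra.adjoin K {α} := hgen ▸ Algebra.mem_top
    induction hx using Algebra.adjoin_induction with
    | mem x hx => exact ⟨0, 1, by simpa using hx⟩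
    | algebraMap r => exact ⟨r, 0, by simp⟩
    | add x y _ _ hx hy =>
      obtain ⟨p, q, rfl⟩ := hx
      obtain ⟨r, s, rfl⟩ := hy
      exact ⟨p + r, q + s, by simp only [map_add]; ring⟩
    | mul x y _ _ hx hy =>
      obtain ⟨p, q, rfl⟩ := hx
      obtain ⟨r, s, rfl⟩ := hy
      refine ⟨p * r - q * s * a₂, p * s + q * r - q * s * a₁, ?_⟩
      simp only [map_add, map_sub, map_mul]
      linear_combination (algebraMap K L q * algebraMap K L s) * hα2
  refine exists_trace_zero_mul_trace_one_iff h2 (δ := α + algebraMap K L (a₁ / 2))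
    (d := a₁ ^ 2 / 4 - a₂) ?_ ?_ ?_ ?_ β
  · exact fun h => hα (by simpa using sub_mem h ⟨a₁ / 2, rfl⟩)
  · have h4 : (4 : L) = 2 * 2 := by norm_num
    simp only [map_div₀, map_sub, map_pow, map_ofNat, h4]
    field_simp
    linear_combination 4 * hα2
  · intro x
    obtain ⟨p, q, rfl⟩ := hrep x
    refine ⟨p - q * (a₁ / 2), q, ?_⟩
    simp only [map_sub, map_mul]
    ring
  · intro p q
    rw [← Algebra.smul_def, map_add, map_smul, map_add, htrα, Algebra.trace_algebraMap,
      Algebra.trace_algebraMap, hfin]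
    simp only [nsmul_eq_mul, smul_eq_mul, Nat.cast_ofNat]
    field_simp
    ring
end

section
/- Let K be a field with char(K) ≠ 2, let f = X² + a₁X + a₂ be an irreducible polynomial over K, let α be a root of f, and let L = K(α). Then an element β = b₀ + b₁α of L (with b₀, b₁ ∈ K) lies in T₁·T₁ if and only if ((a₁b₁ + 1)² − 4(b₀ + a₂b₁²))/(a₁² − 4a₂) is a square in K. -/
open Polynomial

/-- The discriminant of an irreducible monic quadratic is nonzero away from characteristic two. -/
theorem discrim_ne_zero_of_irreducible {K : Type*} [Field K] (h2 : (2 : K) ≠ 0) {a₁ a₂ : K}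
    (hirr : Irreducible (X ^ 2 + C a₁ * X + C a₂ : K[X])) : a₁ ^ 2 - 4 * a₂ ≠ 0 := by
  intro hD
  have hroot : IsRoot (X ^ 2 + C a₁ * X + C a₂ : K[X]) (-a₁ / 2) := by
    simp only [IsRoot.def, eval_add, eval_pow, eval_X, eval_mul, eval_C]
    field_simp
    linear_combination -hD
  have hdeg : (X ^ 2 + C a₁ * X + C a₂ : K[X]).natDegree = 1 :=
    natDegree_eq_of_degree_eq_some (degree_eq_one_of_irreducible_of_root hirr hroot)
  have hdeg' : (X ^ 2 + C a₁ * X + C a₂ : K[X]).natDegree = 2 := by compute_degree!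
  omega

section Quadratic

variable {K L : Type*} [Field K] [Field L] [Algebra K L] {a₁ a₂ : K} {α : L}

theorem minpoly_eq_quadratic (hirr : Irreducible (X ^ 2 + C a₁ * X + C a₂ : K[X]))
    (hroot : aeval α (X ^ 2 + C a₁ * X + C a₂ : K[X]) = 0) :
    minpoly K α = X ^ 2 + C a₁ * X + C a₂ :=
  (minpoly.eq_of_irreducible_of_monic hirr hroot (by monicity!)).symm

theorem natDegree_minpoly_quadratic (hirr : Irreducible (X ^ 2 + C a₁ * X + C a₂ : K[X]))
    (hroot : aeval α (X ^ 2 + C a₁ * X + C a₂ : K[X]) = 0) :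
    (minpoly K α).natDegree = 2 := by
  rw [minpoly_eq_quadratic hirr hroot]
  compute_degree!

theorem eq_zero_of_add_mul_root_eq_zero (hirr : Irreducible (X ^ 2 + C a₁ * X + C a₂ : K[X]))
    (hroot : aeval α (X ^ 2 + C a₁ * X + C a₂ : K[X]) = 0) {u v : K}
    (h : algebraMap K L u + algebraMap K L v * α = 0) : u = 0 ∧ v = 0 := by
  have hv : v = 0 := by
    by_contra hv
    have hv' : algebraMap K L v ≠ 0 := by simpa using hv
    have hα : α ∈ (algebraMap K L).range := ⟨-u / v, by
      rw [map_div₀, map_neg]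
      field_simp
      linear_combination -h⟩
    have := natDegree_minpoly_quadratic hirr hroot
    have := minpoly.natDegree_eq_one_iff.2 hα
    omega
  subst hv
  simpa using h

variable [FiniteDimensional K L]

theorem exists_eq_add_mul_root (hirr : Irreducible (X ^ 2 + C a₁ * X + C a₂ : K[X]))
    (hroot : aeval α (X ^ 2 + C a₁ * X + C a₂ : K[X]) = 0)
    (hgen : Algebra.adjoin K {α} = ⊤) (x : L) :
    ∃ u v : K, x = algebraMap K L u + algebraMap K L v * α := by
  let pb := PowerBasis.ofAdjoinEqTop (Algebra.IsIntegral.isIntegral (R := K) α) hgen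
  have hg : pb.gen = α := PowerBasis.ofAdjoinEqTop_gen _ _
  have hd : pb.dim = 2 := by
    rw [← pb.natDegree_minpoly, hg, natDegree_minpoly_quadratic hirr hroot]
  obtain ⟨f, hf, rfl⟩ := pb.exists_eq_aeval x
  obtain ⟨v, u, rfl⟩ := exists_eq_X_add_C_of_natDegree_le_one (p := f) (by omega)
  exact ⟨u, v, by simp [hg, add_comm]⟩

theorem trace_add_mul_root (hirr : Irreducible (X ^ 2 + C a₁ * X + C a₂ : K[X]))
    (hroot : aeval α (X ^ 2 + C a₁ * X + C a₂ : K[X]) = 0)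
    (hgen : Algebra.adjoin K {α} = ⊤) (u v : K) :
    Algebra.trace K L (algebraMap K L u + algebraMap K L v * α) = 2 * u - a₁ * v := by
  let pb := PowerBasis.ofAdjoinEqTop (Algebra.IsIntegral.isIntegral (R := K) α) hgen
  have hg : pb.gen = α := PowerBasis.ofAdjoinEqTop_gen _ _
  have hd : Module.finrank K L = 2 := by
    rw [pb.finrank, ← pb.natDegree_minpoly, hg, natDegree_minpoly_quadratic hirr hroot]
  have ht : Algebra.trace K L α = -a₁ := by
    rw [← hg, pb.trace_gen_eq_nextCoeff_minpoly, hg,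
      nextCoeff_of_natDegree_pos (by rw [natDegree_minpoly_quadratic hirr hroot]; omega),
      natDegree_minpoly_quadratic hirr hroot, minpoly_eq_quadratic hirr hroot]
    simp [coeff_C]
  rw [← Algebra.smul_def, map_add, map_smul, ht, Algebra.trace_algebraMap, hd]
  simp only [nsmul_eq_mul, smul_eq_mul, Nat.cast_ofNat]
  ring

end Quadratic

/-- For a quadratic extension L = K(α), char K ≠ 2, α a root of the irreducible
polynomial X² + a₁X + a₂: β = b₀ + b₁α ∈ T₁·T₁ iff
((a₁b₁+1)² − 4(b₀ + a₂b₁²))/(a₁² − 4a₂) is a square in K. -/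
theorem stmt_3 (K L : Type*) [Field K] [Field L] [Algebra K L] [FiniteDimensional K L]
    (hchar : ringChar K ≠ 2) (a₁ a₂ : K)
    (hirr : Irreducible (X ^ 2 + C a₁ * X + C a₂ : K[X]))
    (α : L) (hroot : Polynomial.aeval α (X ^ 2 + C a₁ * X + C a₂ : K[X]) = 0)
    (hgen : Algebra.adjoin K {α} = ⊤) (b₀ b₁ : K) :
    (∃ x y : L, Algebra.trace K L x = 1 ∧ Algebra.trace K L y = 1 ∧
        algebraMap K L b₀ + algebraMap K L b₁ * α = x * y) ↔
      IsSquare (((a₁ * b₁ + 1) ^ 2 - 4 * (b₀ + a₂ * b₁ ^ 2)) / (a₁ ^ 2 - 4 * a₂)) := by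
  have h2 : (2 : K) ≠ 0 := Ring.two_ne_zero hchar
  have hD := discrim_ne_zero_of_irreducible h2 hirr
  have hα : α ^ 2 + algebraMap K L a₁ * α + algebraMap K L a₂ = 0 := by simpa using hroot
  have hmul (u v s t : K) : (algebraMap K L u + algebraMap K L v * α) *
      (algebraMap K L s + algebraMap K L t * α) = algebraMap K L (u * s - v * t * a₂) +
        algebraMap K L (u * t + v * s - v * t * a₁) * α := by
    simp only [map_sub, map_add, map_mul]
    linear_combination algebraMap K L v * algebraMap K L t * hα
  constructor
  · rintro ⟨x, y, hx, hy, hxy⟩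
    obtain ⟨u, v, rfl⟩ := exists_eq_add_mul_root hirr hroot hgen x
    obtain ⟨s, t, rfl⟩ := exists_eq_add_mul_root hirr hroot hgen y
    rw [trace_add_mul_root hirr hroot hgen] at hx hy
    rw [hmul] at hxy
    obtain ⟨h0, h1⟩ := eq_zero_of_add_mul_root_eq_zero hirr hroot
      (u := b₀ - (u * s - v * t * a₂)) (v := b₁ - (u * t + v * s - v * t * a₁)) (by
        rw [map_sub _ b₀, map_sub _ b₁]
        linear_combination hxy)
    have hu : u = (1 + a₁ * v) / 2 := by field_simp; linear_combination hx
    have hs : s = (1 + a₁ * t) / 2 := by field_simp; linear_combination hy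
    have hb₀ : b₀ = u * s - v * t * a₂ := sub_eq_zero.1 h0
    have hb₁ : b₁ = (v + t) / 2 := by rw [sub_eq_zero.1 h1, hu, hs]; field_simp; ring
    refine ⟨(v - t) / 2, ?_⟩
    rw [div_eq_iff hD, hb₀, hb₁, hu, hs]
    field_simp
    ring
  · rintro ⟨r, hr⟩
    rw [div_eq_iff hD] at hr
    refine ⟨algebraMap K L ((1 + a₁ * (b₁ + r)) / 2) + algebraMap K L (b₁ + r) * α,
      algebraMap K L ((1 + a₁ * (b₁ - r)) / 2) + algebraMap K L (b₁ - r) * α, ?_, ?_, ?_⟩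
    · rw [trace_add_mul_root hirr hroot hgen]; field_simp; ring
    · rw [trace_add_mul_root hirr hroot hgen]; field_simp; ring
    · rw [hmul]
      congr 3
      · field_simp
        linear_combination -hr
      · field_simp
        ring
end

section
/- Let K be a field of characteristic 2, let f = X² + a₁X + a₂ be an irreducible polynomial over K with a₁ ≠ 0, let α be a root of f, and let L = K(α). Then an element β ∈ L lies in T₀·T₀ if and only if β ∈ K. -/
open Polynomial

/-- In a separable quadratic extension of characteristic two generated by a root of
`X² + a₁X + a₂`, the elements of trace zero are exactly those of the base field. -/
theorem trace_eq_zero_iff_mem_range_of_quadratic {K L : Type*} [Field K] [Field L] [Algebra K L]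
    [FiniteDimensional K L] [CharP K 2] {a₁ a₂ : K} (ha₁ : a₁ ≠ 0)
    (hirr : Irreducible (X ^ 2 + C a₁ * X + C a₂ : K[X]))
    {α : L} (hroot : Polynomial.aeval α (X ^ 2 + C a₁ * X + C a₂ : K[X]) = 0)
    (hgen : Algebra.adjoin K {α} = ⊤) (x : L) :
    Algebra.trace K L x = 0 ↔ x ∈ (algebraMap K L).range := by
  have hdeg : (X ^ 2 + C a₁ * X + C a₂ : K[X]).natDegree = 2 := by compute_degree!
  have hmin : X ^ 2 + C a₁ * X + C a₂ = minpoly K α :=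
    minpoly.eq_of_irreducible_of_monic hirr hroot (by monicity!)
  let pb := PowerBasis.ofAdjoinEqTop (Algebra.IsIntegral.isIntegral (R := K) α) hgen
  have hpb : pb.gen = α := PowerBasis.ofAdjoinEqTop_gen _ _
  have hdim : pb.dim = 2 := by rw [← pb.natDegree_minpoly, hpb, ← hmin, hdeg]
  have htrα : Algebra.trace K L α = -a₁ := by
    have h := pb.trace_gen_eq_nextCoeff_minpoly
    rw [hpb, ← hmin, nextCoeff_of_natDegree_pos (by omega), hdeg] at h
    simpa [coeff_X, coeff_C] using h
  have htr (c : K) : Algebra.trace K L (algebraMap K L c) = 0 := by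
    rw [Algebra.trace_algebraMap, pb.finrank, hdim, two_nsmul, CharTwo.add_self_eq_zero]
  constructor
  · intro hx
    obtain ⟨f, hf, rfl⟩ := pb.exists_eq_aeval x
    obtain ⟨d, c, rfl⟩ := exists_eq_X_add_C_of_natDegree_le_one (show f.natDegree ≤ 1 by omega)
    have hd : d = 0 := by
      simpa [hpb, ← Algebra.smul_def, htr, htrα, ha₁] using hx
    exact ⟨c, by simp [hd]⟩
  · rintro ⟨c, rfl⟩
    exact htr c

/-- For a quadratic extension L = K(α), char K = 2, α a root of the irreducible
polynomial X² + a₁X + a₂ with a₁ ≠ 0: β ∈ T₀·T₀ iff β ∈ K. -/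
theorem stmt_4 (K L : Type*) [Field K] [Field L] [Algebra K L] [FiniteDimensional K L]
    (hchar : ringChar K = 2) (a₁ a₂ : K) (ha₁ : a₁ ≠ 0)
    (hirr : Irreducible (X ^ 2 + C a₁ * X + C a₂ : K[X]))
    (α : L) (hroot : Polynomial.aeval α (X ^ 2 + C a₁ * X + C a₂ : K[X]) = 0)
    (hgen : Algebra.adjoin K {α} = ⊤) (β : L) :
    (∃ x y : L, Algebra.trace K L x = 0 ∧ Algebra.trace K L y = 0 ∧ β = x * y) ↔
      β ∈ (algebraMap K L).range := by
  have : CharP K 2 := ringChar.of_eq hchar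
  simp only [trace_eq_zero_iff_mem_range_of_quadratic ha₁ hirr hroot hgen]
  constructor
  · rintro ⟨x, y, hx, hy, rfl⟩
    exact mul_mem hx hy
  · intro hβ
    exact ⟨β, 1, hβ, one_mem _, (mul_one β).symm⟩
end

section
/- Let K be a field of characteristic 2, let f = X² + a₁X + a₂ be an irreducible polynomial over K with a₁ ≠ 0, let α be a root of f, and let L = K(α). Then an element β = b₀ + b₁α of L (with b₀, b₁ ∈ K) lies in T₁·T₁ if and only if the quadratic equation X² + (a₁b₁ + 1)X + a₂/a₁² + b₀ = 0 has a solution in K. -/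
open Polynomial

section Quadratic

variable {K L : Type*} [Field K] [Field L] [Algebra K L] {a₁ a₂ : K} {α : L}

theorem sq_eq_of_aeval_quadratic_eq_zero
    (hroot : aeval α (X ^ 2 + C a₁ * X + C a₂ : K[X]) = 0) :
    α ^ 2 = -(algebraMap K L a₁ * α + algebraMap K L a₂) := by
  simp only [map_add, map_mul, map_pow, aeval_X, aeval_C] at hroot
  linear_combination hroot

theorem exists_eq_add_mul_of_adjoin_eq_top
    (hroot : aeval α (X ^ 2 + C a₁ * X + C a₂ : K[X]) = 0)
    (hgen : Algebra.adjoin K {α} = ⊤) (x : L) :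
    ∃ c d : K, x = algebraMap K L c + algebraMap K L d * α := by
  have hsq := sq_eq_of_aeval_quadratic_eq_zero hroot
  have hx : x ∈ Algebra.adjoin K {α} := hgen ▸ Algebra.mem_top
  induction hx using Algebra.adjoin_induction with
  | mem y hy =>
    obtain rfl := Set.mem_singleton_iff.mp hy
    exact ⟨0, 1, by simp⟩
  | algebraMap r => exact ⟨r, 0, by simp⟩
  | add y z _ _ hy hz =>
    obtain ⟨c, d, rfl⟩ := hy
    obtain ⟨c', d', rfl⟩ := hz
    exact ⟨c + c', d + d', by simp only [map_add]; ring⟩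
  | mul y z _ _ hy hz =>
    obtain ⟨c, d, rfl⟩ := hy
    obtain ⟨c', d', rfl⟩ := hz
    refine ⟨c * c' - d * d' * a₂, c * d' + d * c' - d * d' * a₁, ?_⟩
    simp only [map_add, map_sub, map_mul]
    linear_combination (algebraMap K L d * algebraMap K L d') * hsq

theorem trace_add_mul_of_quadratic (hirr : Irreducible (X ^ 2 + C a₁ * X + C a₂ : K[X]))
    (hroot : aeval α (X ^ 2 + C a₁ * X + C a₂ : K[X]) = 0)
    (hgen : Algebra.adjoin K {α} = ⊤) (c d : K) :
    Algebra.trace K L (algebraMap K L c + algebraMap K L d * α) = 2 * c - a₁ * d := by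
  have hmonic : (X ^ 2 + C a₁ * X + C a₂ : K[X]).Monic := by monicity!
  have hdeg : (X ^ 2 + C a₁ * X + C a₂ : K[X]).natDegree = 2 := by compute_degree!
  have hmin := minpoly.eq_of_irreducible_of_monic hirr hroot hmonic
  have hint : IsIntegral K α := ⟨_, hmonic, by rwa [← aeval_def]⟩
  let B := PowerBasis.ofAdjoinEqTop hint hgen
  have hB : B.gen = α := PowerBasis.ofAdjoinEqTop_gen hint hgen
  have hfin : Module.finrank K L = 2 := by
    rw [B.finrank, ← B.natDegree_minpoly, hB, ← hmin, hdeg]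
  have htr : Algebra.trace K L α = -a₁ := by
    have h := B.trace_gen_eq_nextCoeff_minpoly
    rw [hB, ← hmin, nextCoeff_of_natDegree_pos (by omega), hdeg] at h
    simpa [coeff_X, coeff_C] using h
  rw [map_add, Algebra.trace_algebraMap, hfin, ← Algebra.smul_def, map_smul, htr]
  simp only [nsmul_eq_mul, smul_eq_mul]
  push_cast
  ring

theorem add_mul_inj_of_quadratic (hirr : Irreducible (X ^ 2 + C a₁ * X + C a₂ : K[X]))
    (hroot : aeval α (X ^ 2 + C a₁ * X + C a₂ : K[X]) = 0) {c d c' d' : K}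
    (h : algebraMap K L c + algebraMap K L d * α = algebraMap K L c' + algebraMap K L d' * α) :
    c = c' ∧ d = d' := by
  have hdeg : (X ^ 2 + C a₁ * X + C a₂ : K[X]).natDegree = 2 := by compute_degree!
  have hdvd : (X ^ 2 + C a₁ * X + C a₂ : K[X]) ∣ C (d - d') * X + C (c - c') := by
    rw [minpoly.eq_of_irreducible_of_monic hirr hroot (by monicity!)]
    apply minpoly.dvd
    simp only [map_add, map_mul, aeval_X, aeval_C, map_sub]
    linear_combination h
  have hzero : C (d - d') * X + C (c - c') = 0 := by
    refine eq_zero_of_dvd_of_natDegree_lt hdvd ?_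
    rw [hdeg]
    exact natDegree_linear_le.trans_lt one_lt_two
  have h₀ := congrArg (coeff · 0) hzero
  have h₁ := congrArg (coeff · 1) hzero
  simp only [coeff_add, coeff_C_mul, coeff_X_zero, coeff_X_one, coeff_C_zero, coeff_C_succ,
    coeff_zero, mul_zero, mul_one, zero_add, add_zero] at h₀ h₁
  exact ⟨sub_eq_zero.mp h₀, sub_eq_zero.mp h₁⟩

end Quadratic

/-- For a quadratic extension L = K(α), char K = 2, α a root of the irreducible
polynomial X² + a₁X + a₂ with a₁ ≠ 0: β = b₀ + b₁α ∈ T₁·T₁ iff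
X² + (a₁b₁+1)X + a₂/a₁² + b₀ = 0 has a solution in K. -/
theorem stmt_5 (K L : Type*) [Field K] [Field L] [Algebra K L] [FiniteDimensional K L]
    (hchar : ringChar K = 2) (a₁ a₂ : K) (ha₁ : a₁ ≠ 0)
    (hirr : Irreducible (X ^ 2 + C a₁ * X + C a₂ : K[X]))
    (α : L) (hroot : Polynomial.aeval α (X ^ 2 + C a₁ * X + C a₂ : K[X]) = 0)
    (hgen : Algebra.adjoin K {α} = ⊤) (b₀ b₁ : K) :
    (∃ x y : L, Algebra.trace K L x = 1 ∧ Algebra.trace K L y = 1 ∧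
        algebraMap K L b₀ + algebraMap K L b₁ * α = x * y) ↔
      (∃ t : K, t ^ 2 + (a₁ * b₁ + 1) * t + a₂ / a₁ ^ 2 + b₀ = 0) := by
  have h2 : (2 : K) = 0 := by
    have := ringChar.Nat.cast_ringChar (R := K)
    rwa [hchar] at this
  have hsq := sq_eq_of_aeval_quadratic_eq_zero hroot
  have htrace (c d : K) :
      Algebra.trace K L (algebraMap K L c + algebraMap K L d * α) = 1 ↔ d = a₁⁻¹ := by
    rw [trace_add_mul_of_quadratic hirr hroot hgen, ← mul_eq_one_iff_eq_inv₀ ha₁]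
    constructor <;> intro h
    · linear_combination h - (c - a₁ * d) * h2
    · linear_combination h + (c - a₁ * d) * h2
  have hmul (s u : K) :
      (algebraMap K L s + algebraMap K L a₁⁻¹ * α) * (algebraMap K L u + algebraMap K L a₁⁻¹ * α) =
        algebraMap K L (s * u - a₂ / a₁ ^ 2) + algebraMap K L ((s + u - 1) * a₁⁻¹) * α := by
    have hinv : algebraMap K L a₁ * algebraMap K L a₁⁻¹ = 1 := by
      rw [← map_mul, mul_inv_cancel₀ ha₁, map_one]
    rw [div_eq_mul_inv, ← inv_pow]
    simp only [map_add, map_sub, map_mul, map_pow, map_one]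
    linear_combination (algebraMap K L a₁⁻¹) ^ 2 * hsq - algebraMap K L a₁⁻¹ * α * hinv
  constructor
  · rintro ⟨x, y, hx, hy, hxy⟩
    obtain ⟨s, d, rfl⟩ := exists_eq_add_mul_of_adjoin_eq_top hroot hgen x
    obtain ⟨u, e, rfl⟩ := exists_eq_add_mul_of_adjoin_eq_top hroot hgen y
    obtain rfl := (htrace s d).mp hx
    obtain rfl := (htrace u e).mp hy
    rw [hmul] at hxy
    obtain ⟨rfl, rfl⟩ := add_mul_inj_of_quadratic hirr hroot hxy
    refine ⟨s, ?_⟩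
    rw [mul_comm _ a₁⁻¹, mul_inv_cancel_left₀ ha₁]
    linear_combination (s ^ 2 + s * u) * h2
  · rintro ⟨t, ht⟩
    refine ⟨_, _, (htrace t _).mpr rfl, (htrace (t + a₁ * b₁ + 1) _).mpr rfl, ?_⟩
    rw [hmul]
    congr 2
    · linear_combination -ht + (a₂ / a₁ ^ 2 + b₀) * h2
    · congr 1
      field_simp
      linear_combination -t * h2
end

section
/- Let q be a prime power not divisible by 2 or 3, K = F_q and L = F_{q^3}. Then T₀·T₀ ≠ F_{q^3}; that is, there exists an element of F_{q^3} that cannot be written as a product x·y with x, y ∈ F_{q^3} and Tr(x) = Tr(y) = 0. -/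
section FiniteFieldCubic

variable {K L : Type*} [Field K] [Field L] [Algebra K L] [Fintype K] [Fintype L]

open FiniteField in
/-- In a cubic extension of finite fields, the trace is the sum of the three Frobenius
conjugates. -/
theorem algebraMap_trace_of_finrank_eq_three (hrank : Module.finrank K L = 3) (x : L) :
    algebraMap K L (Algebra.trace K L x) =
      x + frobeniusAlgHom K L x + frobeniusAlgHom K L (frobeniusAlgHom K L x) := by
  rw [algebraMap_trace_eq_sum_pow, hrank]
  simp [Finset.sum_range_succ, ← pow_mul, sq]

open FiniteField in
/-- The quadratic form `z ↦ 2 Tr(z²) - Tr(z)²` takes square values on products of two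
trace-zero elements of a cubic extension of finite fields. -/
theorem isSquare_two_mul_trace_sq_sub_of_trace_eq_zero (h3 : (3 : K) ≠ 0)
    (hrank : Module.finrank K L = 3) {x y : L}
    (hx : Algebra.trace K L x = 0) (hy : Algebra.trace K L y = 0) :
    IsSquare (2 * Algebra.trace K L ((x * y) ^ 2) - Algebra.trace K L (x * y) ^ 2) := by
  have tr := algebraMap_trace_of_finrank_eq_three hrank
  set φ := frobeniusAlgHom K L
  have hx' : φ (φ x) = - x - φ x := by
    have := tr x
    rw [hx, map_zero] at this
    linear_combination -this
  have hy' : φ (φ y) = - y - φ y := by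
    have := tr y
    rw [hy, map_zero] at this
    linear_combination -this
  have h3L : (3 : L) ≠ 0 := by
    rw [← map_ofNat (algebraMap K L) 3]
    exact (map_ne_zero (algebraMap K L)).2 h3
  refine ⟨Algebra.trace K L (x * φ y - y * φ x) / 3, (algebraMap K L).injective ?_⟩
  have hd : algebraMap K L (Algebra.trace K L (x * φ y - y * φ x) / 3) = x * φ y - y * φ x := by
    rw [map_div₀, tr]
    simp only [map_sub, map_mul, hx', hy', map_ofNat, map_neg]
    field_simp
    ring
  rw [map_mul (algebraMap K L), hd]
  simp only [map_sub, map_mul, map_pow, map_ofNat, tr, hx', hy']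
  ring

/-- A cubic extension of finite fields contains a trace-zero element whose square has nonzero
trace. -/
theorem exists_trace_eq_zero_trace_sq_ne_zero (h2 : (2 : K) ≠ 0) (h3 : (3 : K) ≠ 0)
    (hrank : Module.finrank K L = 3) :
    ∃ t : L, Algebra.trace K L t = 0 ∧ Algebra.trace K L (t ^ 2) ≠ 0 := by
  have : FiniteDimensional K L := Module.finite_of_finrank_eq_succ hrank
  by_contra! h
  have key : ∀ s t : L, Algebra.trace K L s = 0 → Algebra.trace K L t = 0 →
      Algebra.trace K L (s * t) = 0 := by
    intro s t hs ht
    have hst := h (s + t) (by rw [map_add, hs, ht, add_zero])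
    rw [show (s + t) ^ 2 = s ^ 2 + t ^ 2 + (s * t + s * t) by ring, map_add, map_add, h s hs,
      h t ht, map_add] at hst
    have : 2 * Algebra.trace K L (s * t) = 0 := by linear_combination hst
    exact (mul_eq_zero.1 this).resolve_left h2
  have zero_of_trace : ∀ s : L, Algebra.trace K L s = 0 → s = 0 := by
    intro s hs
    refine (traceForm_nondegenerate K L).1 s fun w => ?_
    set c := Algebra.trace K L w / 3
    have hc : Algebra.trace K L (w - algebraMap K L c) = 0 := by
      rw [map_sub, Algebra.trace_algebraMap, hrank, nsmul_eq_mul]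
      simp only [c]
      push_cast
      field_simp
      ring
    have := key s _ hs hc
    rw [mul_sub, map_sub, mul_comm s (algebraMap K L c), ← Algebra.smul_def, map_smul, hs,
      smul_zero, sub_zero] at this
    rwa [Algebra.traceForm_apply]
  have := LinearMap.finrank_le_finrank_of_injective
    (LinearMap.ker_eq_bot.1 (LinearMap.ker_eq_bot'.2 zero_of_trace))
  rw [hrank, Module.finrank_self] at this
  omega

open Polynomial in
/-- A nondegenerate diagonal binary quadratic form over a finite field of odd order represents
every element. -/
theorem FiniteField.exists_mul_sq_add_mul_sq_eq (hodd : Fintype.card K % 2 = 1) {a b : K}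
    (ha : a ≠ 0) (hb : b ≠ 0) (n : K) : ∃ u v : K, a * u ^ 2 + b * v ^ 2 = n := by
  obtain ⟨u, v, h⟩ := FiniteField.exists_root_sum_quadratic
    (f := C a * X ^ 2 + C 0 * X + C (-n)) (g := C b * X ^ 2 + C 0 * X + C 0)
    (degree_quadratic ha) (degree_quadratic hb) hodd
  refine ⟨u, v, ?_⟩
  simp only [eval_add, eval_mul, eval_C, eval_pow, eval_X] at h
  linear_combination h

end FiniteFieldCubic

/-- A finite field whose order is prime to the prime `p` does not have characteristic `p`. -/
theorem FiniteField.natCast_ne_zero_of_not_dvd_card {K : Type*} [Field K] [Fintype K] {p : ℕ}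
    (hp : p.Prime) (h : ¬ p ∣ Fintype.card K) : (p : K) ≠ 0 := by
  intro h0
  obtain ⟨r, hr, n, hrp, hn⟩ := FiniteField.card' K
  have : r = p := (Nat.prime_dvd_prime_iff_eq hrp hp).1 ((CharP.cast_eq_zero_iff K r p).1 h0)
  exact h (by rw [hn, this]; exact dvd_pow_self p n.ne_zero)

/-- For K = F_q, L = F_{q³} with q a prime power coprime to 2 and 3, T₀·T₀ ≠ L:
some element of L is not a product of two trace-zero elements. -/
theorem stmt_7 (q : ℕ) (hq : IsPrimePow q) (hq2 : ¬ 2 ∣ q) (hq3 : ¬ 3 ∣ q)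
    (K L : Type*) [Field K] [Field L] [Algebra K L] [Fintype K] [Fintype L]
    (hcard : Fintype.card K = q) (hrank : Module.finrank K L = 3) :
    ∃ z : L, ¬ ∃ x y : L,
      Algebra.trace K L x = 0 ∧ Algebra.trace K L y = 0 ∧ z = x * y := by
  subst hcard
  have h2 : (2 : K) ≠ 0 := FiniteField.natCast_ne_zero_of_not_dvd_card Nat.prime_two hq2
  have h3 : (3 : K) ≠ 0 := FiniteField.natCast_ne_zero_of_not_dvd_card Nat.prime_three hq3
  obtain ⟨n, hn⟩ := FiniteField.exists_nonsquare (F := K) fun h => by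
    have := FiniteField.even_card_of_char_two h
    omega
  obtain ⟨t, ht, ht2⟩ := exists_trace_eq_zero_trace_sq_ne_zero h2 h3 hrank
  obtain ⟨u, v, huv⟩ := FiniteField.exists_mul_sq_add_mul_sq_eq (by omega) (neg_ne_zero.2 h3)
    (mul_ne_zero h2 ht2) n
  refine ⟨algebraMap K L u + v • t, ?_⟩
  rintro ⟨x, y, hx, hy, hz⟩
  refine hn ?_
  convert isSquare_two_mul_trace_sq_sub_of_trace_eq_zero h3 hrank hx hy using 1
  have hsq : (algebraMap K L u + v • t) ^ 2 =
      algebraMap K L (u ^ 2) + (2 * u * v) • t + (v ^ 2) • t ^ 2 := by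
    simp only [Algebra.smul_def, map_pow, map_mul, map_ofNat]
    ring
  rw [← hz, hsq, ← huv]
  simp only [map_add, map_smul, Algebra.trace_algebraMap, hrank, ht, nsmul_eq_mul, smul_eq_mul]
  push_cast
  ring
end

section
/- Let K be a field with char(K) ≠ 2 and char(K) ≠ 3, let f = X³ − d be an irreducible polynomial over K, let α be a root of f, and let L = K(α). Then an element β = b₀ + b₁α + b₂α² of L (with b₀, b₁, b₂ ∈ K) lies in T₀·T₀ if and only if b₀² − 4d·b₁·b₂ is a square in K. -/
open Polynomial

section PureCubic

variable {K L : Type*} [Field K] [Field L] [Algebra K L] {d : K} {α : L}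

/-- The basis `1, α, α²` of a pure cubic extension generated by a root `α` of `X³ - d`. -/
theorem exists_basis_of_irreducible_X_pow_three_sub_C
    (hirr : Irreducible (X ^ 3 - C d : K[X]))
    (hroot : Polynomial.aeval α (X ^ 3 - C d : K[X]) = 0)
    (hgen : Algebra.adjoin K {α} = ⊤) :
    ∃ b : Module.Basis (Fin 3) K L, ∀ i, b i = α ^ (i : ℕ) := by
  have hmonic : (X ^ 3 - C d : K[X]).Monic := monic_X_pow_sub_C d (by norm_num)
  have hmin := minpoly.eq_of_irreducible_of_monic hirr hroot hmonic
  have hint : IsIntegral K α := ⟨_, hmonic, by simpa [aeval_def] using hroot⟩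
  let pb := PowerBasis.ofAdjoinEqTop hint hgen
  have hdim : pb.dim = 3 := by
    rw [← pb.natDegree_minpoly, PowerBasis.ofAdjoinEqTop_gen, ← hmin, natDegree_X_pow_sub_C]
  refine ⟨pb.basis.reindex (finCongr hdim), fun i => ?_⟩
  rw [Module.Basis.reindex_apply, pb.basis_eq_pow, PowerBasis.ofAdjoinEqTop_gen]
  simp

theorem pow_three_eq_of_aeval_eq_zero
    (hroot : Polynomial.aeval α (X ^ 3 - C d : K[X]) = 0) : α ^ 3 = algebraMap K L d := by
  simpa [sub_eq_zero] using hroot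

theorem trace_pure_cubic (b : Module.Basis (Fin 3) K L) (hb : ∀ i, b i = α ^ (i : ℕ))
    (hα : α ^ 3 = algebraMap K L d) (c₀ c₁ c₂ : K) :
    Algebra.trace K L (algebraMap K L c₀ + algebraMap K L c₁ * α + algebraMap K L c₂ * α ^ 2)
      = 3 * c₀ := by
  have h0 : (algebraMap K L c₀ + algebraMap K L c₁ * α + algebraMap K L c₂ * α ^ 2) * b 0
      = c₀ • b 0 + c₁ • b 1 + c₂ • b 2 := by
    simp [hb, Algebra.smul_def]
  have h1 : (algebraMap K L c₀ + algebraMap K L c₁ * α + algebraMap K L c₂ * α ^ 2) * b 1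
      = (c₂ * d) • b 0 + c₀ • b 1 + c₁ • b 2 := by
    simp only [hb, Algebra.smul_def, map_mul, ← hα, Fin.val_zero, Fin.val_one, Fin.val_two]
    ring
  have h2 : (algebraMap K L c₀ + algebraMap K L c₁ * α + algebraMap K L c₂ * α ^ 2) * b 2
      = (c₁ * d) • b 0 + (c₂ * d) • b 1 + c₀ • b 2 := by
    simp only [hb, Algebra.smul_def, map_mul, ← hα, Fin.val_zero, Fin.val_one, Fin.val_two]
    ring
  rw [Algebra.trace_eq_matrix_trace b, Matrix.trace_fin_three]
  simp only [Algebra.leftMulMatrix_eq_repr_mul, h0, h1, h2]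
  simp
  ring

theorem exists_coords_pure_cubic (b : Module.Basis (Fin 3) K L) (hb : ∀ i, b i = α ^ (i : ℕ))
    (x : L) : ∃ c₀ c₁ c₂ : K,
      x = algebraMap K L c₀ + algebraMap K L c₁ * α + algebraMap K L c₂ * α ^ 2 := by
  refine ⟨b.repr x 0, b.repr x 1, b.repr x 2, ?_⟩
  conv_lhs => rw [← b.sum_repr x]
  simp [Fin.sum_univ_three, hb, Algebra.smul_def]

theorem coords_unique_pure_cubic (b : Module.Basis (Fin 3) K L) (hb : ∀ i, b i = α ^ (i : ℕ))
    {c₀ c₁ c₂ e₀ e₁ e₂ : K}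
    (h : algebraMap K L c₀ + algebraMap K L c₁ * α + algebraMap K L c₂ * α ^ 2
      = algebraMap K L e₀ + algebraMap K L e₁ * α + algebraMap K L e₂ * α ^ 2) :
    c₀ = e₀ ∧ c₁ = e₁ ∧ c₂ = e₂ := by
  have h' : c₀ • b 0 + c₁ • b 1 + c₂ • b 2 = e₀ • b 0 + e₁ • b 1 + e₂ • b 2 := by
    simpa [hb, Algebra.smul_def] using h
  have hr := fun i => DFunLike.congr_fun (congrArg b.repr h') i
  exact ⟨by simpa using hr 0, by simpa using hr 1, by simpa using hr 2⟩

end PureCubic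

/-- For a cubic extension L = K(α), char K ∉ {2,3}, α a root of the irreducible
polynomial X³ − d: β = b₀ + b₁α + b₂α² ∈ T₀·T₀ iff b₀² − 4db₁b₂ is a square in K. -/
theorem stmt_8 (K L : Type*) [Field K] [Field L] [Algebra K L] [FiniteDimensional K L]
    (hchar2 : ringChar K ≠ 2) (hchar3 : ringChar K ≠ 3) (d : K)
    (hirr : Irreducible (X ^ 3 - C d : K[X]))
    (α : L) (hroot : Polynomial.aeval α (X ^ 3 - C d : K[X]) = 0)
    (hgen : Algebra.adjoin K {α} = ⊤) (b₀ b₁ b₂ : K) :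
    (∃ x y : L, Algebra.trace K L x = 0 ∧ Algebra.trace K L y = 0 ∧
        algebraMap K L b₀ + algebraMap K L b₁ * α + algebraMap K L b₂ * α ^ 2 = x * y) ↔
      IsSquare (b₀ ^ 2 - 4 * d * b₁ * b₂) := by
  obtain ⟨b, hb⟩ := exists_basis_of_irreducible_X_pow_three_sub_C hirr hroot hgen
  have hα := pow_three_eq_of_aeval_eq_zero hroot
  have h2 : (2 : K) ≠ 0 := Ring.two_ne_zero hchar2
  have h3 : (3 : K) ≠ 0 := fun h =>
    hchar3 (((Nat.prime_dvd_prime_iff_eq (CharP.char_prime_of_ne_zero K (p := ringChar K)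
      (fun h0 => by
        have := (ringChar.spec K 3).1 (by exact_mod_cast h)
        simp [h0] at this)) Nat.prime_three).1
      ((ringChar.spec K 3).1 (by exact_mod_cast h))))
  have hd : d ≠ 0 := by
    rintro rfl
    have hu := hirr.isUnit_or_isUnit (a := X) (b := X ^ 2) (by simp; ring)
    simp [isUnit_pow_iff, not_isUnit_X] at hu
  have key (p q r s : K) :
      (algebraMap K L p * α + algebraMap K L q * α ^ 2) *
        (algebraMap K L r * α + algebraMap K L s * α ^ 2) =
      algebraMap K L (d * (p * s + q * r)) + algebraMap K L (d * (q * s)) * α +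
        algebraMap K L (p * r) * α ^ 2 := by
    simp only [map_mul, map_add, ← hα]
    ring
  have htr (p q : K) :
      Algebra.trace K L (algebraMap K L p * α + algebraMap K L q * α ^ 2) = 0 := by
    simpa using trace_pure_cubic b hb hα 0 p q
  constructor
  · rintro ⟨x, y, hx, hy, hxy⟩
    obtain ⟨p₀, p, q, rfl⟩ := exists_coords_pure_cubic b hb x
    obtain ⟨r₀, r, s, rfl⟩ := exists_coords_pure_cubic b hb y
    rw [trace_pure_cubic b hb hα] at hx hy
    obtain rfl : p₀ = 0 := by simpa [h3] using hx
    obtain rfl : r₀ = 0 := by simpa [h3] using hy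
    rw [map_zero, zero_add, zero_add, key] at hxy
    obtain ⟨rfl, rfl, rfl⟩ := coords_unique_pure_cubic b hb hxy
    exact ⟨d * (p * s - q * r), by ring⟩
  · rintro ⟨t, ht⟩
    suffices ∃ p q r s : K, b₀ = d * (p * s + q * r) ∧ b₁ = d * (q * s) ∧ b₂ = p * r by
      obtain ⟨p, q, r, s, rfl, rfl, rfl⟩ := this
      exact ⟨_, _, htr p q, htr r s, (key p q r s).symm⟩
    by_cases hb₂ : b₂ = 0
    · exact ⟨0, 1, b₀ / d, b₁ / d, by field_simp; ring, by field_simp, by simp [hb₂]⟩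
    · refine ⟨b₂, (b₀ + t) / (2 * d), 1, (b₀ - t) / (2 * d * b₂), ?_, ?_, by ring⟩
      · field_simp
        ring
      · field_simp
        linear_combination -ht
end

section
/- Let q = 3^h be a power of 3, let X³ − X + a be an irreducible polynomial over F_q, let α be a root of it, and let F_{q^3} = F_q(α). Then an element β = b₀ + b₁α + b₂α² of F_{q^3} (with b₀, b₁, b₂ ∈ F_q) lies in T₀·T₀ if and only if b₁² − b₀b₂ is a square in F_{q^3}. -/
open Polynomial

theorem three_eq_zero_of_card_eq_three_pow {K : Type*} [Field K] [Fintype K] {h : ℕ}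
    (hcard : Fintype.card K = 3 ^ h) : (3 : K) = 0 := by
  have hc : (3 : K) ^ h = 0 := by
    have hzero := Nat.cast_card_eq_zero K
    rw [hcard] at hzero
    exact_mod_cast hzero
  exact eq_zero_of_pow_eq_zero hc

/-- An element of the base field that is a square in a cubic extension is already a square. -/
theorem isSquare_of_isSquare_algebraMap {K L : Type*} [Field K] [Field L] [Algebra K L]
    (hrank : Module.finrank K L = 3) {d : K} (hd : IsSquare (algebraMap K L d)) :
    IsSquare d := by
  obtain ⟨s, hs⟩ := hd
  have hn : d ^ 3 = Algebra.norm K s * Algebra.norm K s := by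
    rw [← map_mul, ← hs, Algebra.norm_algebraMap, hrank]
  rcases eq_or_ne d 0 with rfl | h0
  · exact IsSquare.zero
  · refine ⟨Algebra.norm K s / d, ?_⟩
    field_simp
    linear_combination hn

section Cubic

variable {K L : Type*} [Field K] [Field L] [Algebra K L] {a : K} {α : L}

theorem monic_cube_sub_X_add_C (a : K) : (X ^ 3 - X + C a : K[X]).Monic := by
  monicity!

theorem natDegree_cube_sub_X_add_C (a : K) : (X ^ 3 - X + C a : K[X]).natDegree = 3 := by
  compute_degree!

theorem minpoly_eq_cube_sub_X_add_C (hirr : Irreducible (X ^ 3 - X + C a : K[X]))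
    (hroot : aeval α (X ^ 3 - X + C a : K[X]) = 0) :
    minpoly K α = X ^ 3 - X + C a :=
  (minpoly.eq_of_irreducible_of_monic hirr hroot (monic_cube_sub_X_add_C a)).symm

theorem eq_zero_of_quadratic_eq_zero (hirr : Irreducible (X ^ 3 - X + C a : K[X]))
    (hroot : aeval α (X ^ 3 - X + C a : K[X]) = 0) {u v w : K}
    (h : algebraMap K L u + algebraMap K L v * α + algebraMap K L w * α ^ 2 = 0) :
    u = 0 ∧ v = 0 ∧ w = 0 := by
  have hdvd : (X ^ 3 - X + C a : K[X]) ∣ C w * X ^ 2 + C v * X + C u := by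
    rw [← minpoly_eq_cube_sub_X_add_C hirr hroot]
    apply minpoly.dvd
    simp only [map_add, map_mul, map_pow, aeval_C, aeval_X]
    linear_combination h
  have hzero : C w * X ^ 2 + C v * X + C u = 0 := by
    refine eq_zero_of_dvd_of_natDegree_lt hdvd ?_
    rw [natDegree_cube_sub_X_add_C]
    exact natDegree_quadratic_le.trans_lt (by norm_num)
  refine ⟨?_, ?_, ?_⟩
  · simpa using congrArg (coeff · 0) hzero
  · simpa [coeff_X, coeff_C] using congrArg (coeff · 1) hzero
  · simpa [coeff_X, coeff_C] using congrArg (coeff · 2) hzero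

theorem exists_eq_quadratic (hroot : aeval α (X ^ 3 - X + C a : K[X]) = 0)
    (hgen : Algebra.adjoin K {α} = ⊤) (x : L) :
    ∃ u v w : K,
      x = algebraMap K L u + algebraMap K L v * α + algebraMap K L w * α ^ 2 := by
  have hx : x ∈ Algebra.adjoin K {α} := hgen ▸ Algebra.mem_top
  rw [Algebra.adjoin_singleton_eq_range_aeval] at hx
  obtain ⟨p, rfl⟩ := hx
  have hdeg : (p %ₘ (X ^ 3 - X + C a)).natDegree < 3 := by
    have hlt := natDegree_modByMonic_lt p (monic_cube_sub_X_add_C a) (fun h1 => by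
      simpa [h1] using natDegree_cube_sub_X_add_C a)
    rwa [natDegree_cube_sub_X_add_C] at hlt
  set r := p %ₘ (X ^ 3 - X + C a)
  refine ⟨r.coeff 0, r.coeff 1, r.coeff 2, ?_⟩
  change aeval α p = _
  rw [← aeval_modByMonic_eq_self_of_root hroot, aeval_eq_sum_range' hdeg]
  simp only [Finset.sum_range_succ, Finset.sum_range_zero, Algebra.smul_def, pow_zero, pow_one,
    mul_one, zero_add, r]

theorem trace_root_cube_sub_X_add_C [FiniteDimensional K L]
    (hirr : Irreducible (X ^ 3 - X + C a : K[X]))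
    (hroot : aeval α (X ^ 3 - X + C a : K[X]) = 0) : Algebra.trace K L α = 0 := by
  rw [trace_eq_finrank_mul_minpoly_nextCoeff, minpoly_eq_cube_sub_X_add_C hirr hroot,
    nextCoeff_of_natDegree_pos (by rw [natDegree_cube_sub_X_add_C]; norm_num),
    natDegree_cube_sub_X_add_C]
  simp [coeff_X]

/-- In characteristic three the trace-zero elements are those of degree at most one in the root. -/
theorem trace_eq_zero_iff_exists_linear [FiniteDimensional K L] [Algebra.IsSeparable K L]
    (h3 : (3 : K) = 0) (hrank : Module.finrank K L = 3)
    (hirr : Irreducible (X ^ 3 - X + C a : K[X]))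
    (hroot : aeval α (X ^ 3 - X + C a : K[X]) = 0)
    (hgen : Algebra.adjoin K {α} = ⊤) (x : L) :
    Algebra.trace K L x = 0 ↔ ∃ u v : K, x = algebraMap K L u + algebraMap K L v * α := by
  have htr (u v w : K) :
      Algebra.trace K L (algebraMap K L u + algebraMap K L v * α + algebraMap K L w * α ^ 2) =
        w * Algebra.trace K L (α ^ 2) := by
    simp only [map_add, Algebra.trace_algebraMap, ← Algebra.smul_def, map_smul,
      trace_root_cube_sub_X_add_C hirr hroot, hrank, nsmul_eq_mul, smul_eq_mul]
    push_cast
    linear_combination u * h3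
  constructor
  · intro hx
    obtain ⟨u, v, w, rfl⟩ := exists_eq_quadratic hroot hgen x
    rw [htr] at hx
    have hsq : Algebra.trace K L (α ^ 2) ≠ 0 := by
      intro h0
      apply Algebra.trace_ne_zero K L
      ext y
      obtain ⟨u, v, w, rfl⟩ := exists_eq_quadratic hroot hgen y
      rw [htr, h0, mul_zero, LinearMap.zero_apply]
    obtain rfl := (mul_eq_zero.mp hx).resolve_right hsq
    exact ⟨u, v, by simp⟩
  · rintro ⟨u, v, rfl⟩
    simpa using htr u v 0

end Cubic

/-- For q = 3^h and F_{q³} = F_q(α) with α a root of the irreducible polynomial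
X³ − X + a over F_q: β = b₀ + b₁α + b₂α² ∈ T₀·T₀ iff b₁² − b₀b₂ is a square in F_{q³}. -/
theorem stmt_10 (h : ℕ) (hh : 1 ≤ h)
    (K L : Type*) [Field K] [Field L] [Algebra K L] [Fintype K] [Fintype L]
    (hcard : Fintype.card K = 3 ^ h) (hrank : Module.finrank K L = 3)
    (a : K) (hirr : Irreducible (X ^ 3 - X + C a : K[X]))
    (α : L) (hroot : Polynomial.aeval α (X ^ 3 - X + C a : K[X]) = 0)
    (hgen : Algebra.adjoin K {α} = ⊤) (b₀ b₁ b₂ : K) :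
    (∃ x y : L, Algebra.trace K L x = 0 ∧ Algebra.trace K L y = 0 ∧
        algebraMap K L b₀ + algebraMap K L b₁ * α + algebraMap K L b₂ * α ^ 2 = x * y) ↔
      IsSquare (algebraMap K L (b₁ ^ 2 - b₀ * b₂)) := by
  have h3 : (3 : K) = 0 := three_eq_zero_of_card_eq_three_pow hcard
  have htr := trace_eq_zero_iff_exists_linear h3 hrank hirr hroot hgen
  constructor
  · rintro ⟨x, y, hx, hy, hxy⟩
    obtain ⟨u, v, rfl⟩ := (htr x).mp hx
    obtain ⟨s, t, rfl⟩ := (htr y).mp hy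
    obtain ⟨h0, h1, h2⟩ := eq_zero_of_quadratic_eq_zero hirr hroot
      (u := b₀ - u * s) (v := b₁ - (u * t + v * s)) (w := b₂ - v * t) (by
        simp only [map_sub, map_add, map_mul]
        linear_combination hxy)
    rw [sub_eq_zero] at h0 h1 h2
    refine IsSquare.map (algebraMap K L) ⟨u * t - v * s, ?_⟩
    rw [h0, h1, h2]
    linear_combination (u * t * v * s) * h3
  · intro hsq
    obtain ⟨c, hc⟩ := isSquare_of_isSquare_algebraMap hrank hsq
    rcases eq_or_ne b₂ 0 with rfl | hb
    · exact ⟨algebraMap K L 1 + algebraMap K L 0 * α, algebraMap K L b₀ + algebraMap K L b₁ * α,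
        (htr _).mpr ⟨_, _, rfl⟩, (htr _).mpr ⟨_, _, rfl⟩, by simp⟩
    · refine ⟨algebraMap K L (-(b₁ + c)) + algebraMap K L b₂ * α,
        algebraMap K L (-(b₁ - c) / b₂) + algebraMap K L 1 * α,
        (htr _).mpr ⟨_, _, rfl⟩, (htr _).mpr ⟨_, _, rfl⟩, ?_⟩
      have h0 : b₀ = -(b₁ + c) * (-(b₁ - c) / b₂) := by
        field_simp
        linear_combination -hc
      have h1 : b₁ = -(b₁ + c) + b₂ * (-(b₁ - c) / b₂) := by
        field_simp
        linear_combination b₁ * h3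
      have h0' := congrArg (algebraMap K L) h0
      have h1' := congrArg (algebraMap K L) h1
      rw [map_mul] at h0'
      rw [map_add, map_mul] at h1'
      rw [map_one]
      linear_combination h0' + α * h1'
end

section
/- Let q be a prime power. In the extension F_{q^3}/F_q, the element 1 lies in T₀·T₀ (i.e. there exists x ∈ F_{q^3} with x ≠ 0, Tr(x) = 0 and Tr(x⁻¹) = 0) if and only if q ≡ 0 (mod 3) or q ≡ 1 (mod 3). -/
/-- If `w = x ^ (q - 1)` is a primitive cube root of unity and `q ≡ 1 (mod 3)`,
then the conjugates of `x` sum to zero. -/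
theorem sum_conjugates_eq_zero {L : Type*} [Field L] {q : ℕ} (hq : q % 3 = 1) {x w : L}
    (hx : x ^ q = x * w) (hw3 : w ^ 3 = 1) (hw : 1 + w + w ^ 2 = 0) :
    x + x ^ q + x ^ (q ^ 2) = 0 := by
  have hwq : w ^ q = w := by
    rw [← Nat.div_add_mod q 3, pow_add, pow_mul, hw3, hq, one_pow, one_mul, pow_one]
  rw [sq q, pow_mul, hx, mul_pow, hx, hwq]
  linear_combination x * hw

/-- If the conjugates of `x` and of `x⁻¹` sum to zero, then `x ^ (q - 1)` is a root of
`X ^ 2 + X + 1` fixed by the `q`-power map. -/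
theorem exists_root_of_sum_conjugates_eq_zero {L : Type*} [Field L] {q : ℕ} {x : L} (hx0 : x ≠ 0)
    (h : x + x ^ q + x ^ (q ^ 2) = 0) (h' : x⁻¹ + x⁻¹ ^ q + x⁻¹ ^ (q ^ 2) = 0) :
    ∃ w : L, w ^ q = w ∧ 1 + w + w ^ 2 = 0 := by
  obtain ⟨w, hw⟩ : ∃ w, x ^ q = x * w := ⟨x ^ q / x, by field_simp⟩
  have hw0 : w ≠ 0 := by
    rintro rfl
    exact pow_ne_zero q hx0 (by rw [hw, mul_zero])
  have hwq0 : w ^ q ≠ 0 := pow_ne_zero q hw0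
  have hsq : x ^ (q ^ 2) = x * w * w ^ q := by rw [sq q, pow_mul, hw, mul_pow, hw]
  have e₁ : 1 + w + w * w ^ q = 0 := by
    rw [hsq, hw] at h
    exact mul_left_cancel₀ hx0 (by linear_combination h)
  have e₂ : w * w ^ q + w ^ q + 1 = 0 := by
    rw [inv_pow, inv_pow, hsq, hw] at h'
    field_simp at h'
    linear_combination h'
  have hfix : w ^ q = w := by linear_combination e₂ - e₁
  rw [hfix] at e₁
  exact ⟨w, hfix, by linear_combination e₁⟩

/-- In the extension F_{q³}/F_q, 1 ∈ T₀·T₀ iff q ≡ 0 or 1 (mod 3). -/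
theorem stmt_11 (q : ℕ) (hq : IsPrimePow q)
    (K L : Type*) [Field K] [Field L] [Algebra K L] [Fintype K] [Fintype L]
    (hcard : Fintype.card K = q) (hrank : Module.finrank K L = 3) :
    (∃ x : L, x ≠ 0 ∧ Algebra.trace K L x = 0 ∧ Algebra.trace K L x⁻¹ = 0) ↔
      (q % 3 = 0 ∨ q % 3 = 1) := by
  have htrace (x : L) : Algebra.trace K L x = 0 ↔ x + x ^ q + x ^ (q ^ 2) = 0 := by
    rw [← map_eq_zero (algebraMap K L), FiniteField.algebraMap_trace_eq_sum_pow, hrank,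
      Nat.card_eq_fintype_card, hcard]
    simp [Finset.sum_range_succ]
  have hLcard : Fintype.card L = q ^ 3 := by
    rw [Module.card_eq_pow_finrank (K := K), hcard, hrank]
  have hqL : (q : L) = 0 := by
    have := FiniteField.cast_card_eq_zero K
    rw [hcard] at this
    simpa using congrArg (algebraMap K L) this
  simp only [htrace]
  constructor
  · rintro ⟨x, hx0, h, h'⟩
    obtain ⟨w, hwq, hw⟩ := exists_root_of_sum_conjugates_eq_zero hx0 h h'
    by_contra hmod
    have hq2 : q % 3 = 2 := by omega
    have hw3 : w ^ 3 = 1 := by linear_combination (w - 1) * hw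
    have hw2 : w ^ 2 = w := by
      conv_rhs => rw [← hwq, ← Nat.div_add_mod q 3, pow_add, pow_mul, hw3, hq2, one_pow, one_mul]
    have hw1 : w = 1 := by linear_combination hw3 - (w + 1) * hw2
    have h3 : (3 : L) = 0 := by
      subst hw1
      linear_combination hw
    have hdiv : (q : L) = 3 * (q / 3 : ℕ) + 2 := by
      conv_lhs => rw [← Nat.div_add_mod q 3, hq2]
      push_cast
      ring
    exact one_ne_zero (α := L) (by linear_combination h3 - hqL + hdiv + (q / 3 : ℕ) * h3)
  · rintro (hmod | hmod)
    · have h3 : (3 : L) = 0 := by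
        obtain ⟨p, n, hp, -, hpn⟩ := hq
        have h3p : 3 ∣ p ^ n := hpn ▸ Nat.dvd_of_mod_eq_zero hmod
        have hp3 : p = 3 :=
          ((Nat.prime_dvd_prime_iff_eq Nat.prime_three hp.nat_prime).1
            (Nat.prime_three.dvd_of_dvd_pow h3p)).symm
        rw [← hpn, hp3, Nat.cast_pow] at hqL
        exact_mod_cast eq_zero_of_pow_eq_zero hqL
      refine ⟨1, one_ne_zero, ?_, ?_⟩ <;> simp <;> linear_combination h3
    · obtain ⟨g, hg⟩ := IsCyclic.exists_ofOrder_eq_natCard (α := Lˣ)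
      obtain ⟨k, rfl⟩ : ∃ k, q = 3 * k + 1 := ⟨q / 3, by omega⟩
      have hk : k ≠ 0 := by
        rintro rfl
        exact not_isPrimePow_one hq
      set q := 3 * k + 1 with hqk
      set m := 3 * k ^ 2 + 3 * k + 1
      have horder : orderOf g = (m * (3 * k)) * 3 := by
        rw [hg, Nat.card_units, Nat.card_eq_fintype_card, hLcard, hqk]
        apply Nat.sub_eq_of_eq_add
        ring
      have hprim : IsPrimitiveRoot (g : L) ((m * (3 * k)) * 3) :=
        horder ▸ IsPrimitiveRoot.coe_units_iff.2 (IsPrimitiveRoot.orderOf g)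
      have hw := hprim.pow (by positivity) rfl
      set x : L := (g : L) ^ m with hx
      have hx0 : x ≠ 0 := pow_ne_zero _ g.ne_zero
      rw [pow_mul, ← hx] at hw
      set w := x ^ (3 * k)
      have hxq : x ^ q = x * w := by rw [hqk, pow_succ, mul_comm]
      have hw3 := hw.pow_eq_one
      have hsum : 1 + w + w ^ 2 = 0 := by
        simpa [Finset.sum_range_succ] using hw.geom_sum_eq_zero (by norm_num)
      have hw0 : w ≠ 0 := hw.ne_zero (by norm_num)
      refine ⟨x, hx0, sum_conjugates_eq_zero hmod hxq hw3 hsum,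
        sum_conjugates_eq_zero (w := w⁻¹) hmod ?_ ?_ ?_⟩
      · rw [inv_pow, hxq, mul_inv]
      · rw [inv_pow, hw3, inv_one]
      · field_simp
        linear_combination hsum
end

section
/- Let K be a field and L a field extension of K of degree 3. Then 1 ∈ T₁·T₁ (i.e. there exists x ∈ L with x ≠ 0, Tr(x) = 1 and Tr(x⁻¹) = 1) if and only if char(K) = 2. -/
/-- The Cayley–Hamilton identity for `3 × 3` matrices, with the linear coefficient written as
the trace of the adjugate. -/
theorem Matrix.cayley_hamilton_fin_three {R : Type*} [CommRing R] (M : Matrix (Fin 3) (Fin 3) R) :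
    M * M * M - M.trace • (M * M) + M.adjugate.trace • M - M.det • 1 = 0 := by
  rw [Matrix.adjugate_fin_three, Matrix.det_fin_three]
  ext i j
  fin_cases i <;> fin_cases j <;>
    simp [Matrix.mul_apply, Matrix.trace_fin_three, Fin.sum_univ_three] <;> ring

/-- In a cubic extension, a nonzero element is a root of
`X ^ 3 - Tr(x) X ^ 2 + N(x) Tr(x⁻¹) X - N(x)`. -/
theorem Algebra.cubic_trace_trace_inv {K L : Type*} [Field K] [Field L] [Algebra K L]
    [FiniteDimensional K L] (hdeg : Module.finrank K L = 3) {x : L} (hx : x ≠ 0) :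
    x * x * x - Algebra.trace K L x • (x * x)
      + (Algebra.norm K x * Algebra.trace K L x⁻¹) • x - Algebra.norm K x • (1 : L) = 0 := by
  let b := Module.finBasisOfFinrankEq K L hdeg
  apply Algebra.leftMulMatrix_injective b
  have hinv : Algebra.leftMulMatrix b x * Algebra.leftMulMatrix b x⁻¹ = 1 := by
    rw [← map_mul, mul_inv_cancel₀ hx, map_one]
  have hadj : (Algebra.leftMulMatrix b x).adjugate =
      (Algebra.leftMulMatrix b x).det • Algebra.leftMulMatrix b x⁻¹ := by
    rw [← mul_one (Algebra.leftMulMatrix b x).adjugate, ← hinv, ← mul_assoc,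
      Matrix.adjugate_mul, smul_mul_assoc, one_mul]
  have h := Matrix.cayley_hamilton_fin_three (Algebra.leftMulMatrix b x)
  rw [hadj, Matrix.trace_smul, smul_eq_mul] at h
  simpa only [map_sub, map_add, map_mul, map_smul, map_one, map_zero,
    Algebra.trace_eq_matrix_trace b, Algebra.norm_eq_matrix_det b] using h

/-- An extension of odd degree contains no new square roots of elements of the base field. -/
theorem mem_range_algebraMap_of_sq_mem_of_odd_finrank {K L : Type*} [Field K] [Field L]
    [Algebra K L] [FiniteDimensional K L] (hodd : Odd (Module.finrank K L)) {x : L} {a : K}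
    (hx : x ^ 2 = algebraMap K L a) : x ∈ (algebraMap K L).range := by
  have hdvd : (minpoly K x).natDegree ∣ Module.finrank K L :=
    minpoly.degree_dvd (IsIntegral.of_finite K x)
  have hle : (minpoly K x).natDegree ≤ 2 := by
    have h := Polynomial.natDegree_le_of_dvd
      (minpoly.dvd K x (p := Polynomial.X ^ 2 - Polynomial.C a) (by simp [hx]))
      (Polynomial.X_pow_sub_C_ne_zero two_pos a)
    rwa [Polynomial.natDegree_X_pow_sub_C] at h
  have hpos := minpoly.natDegree_pos (IsIntegral.of_finite K x)
  have hne : (minpoly K x).natDegree ≠ 2 := fun h =>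
    Nat.not_even_iff_odd.mpr hodd (even_iff_two_dvd.mpr (h ▸ hdvd))
  exact minpoly.natDegree_eq_one_iff.mp (by omega)

/-- For a degree-3 extension L/K, 1 ∈ T₁·T₁ iff char K = 2. -/
theorem stmt_12 (K L : Type*) [Field K] [Field L] [Algebra K L] [FiniteDimensional K L]
    (hdeg : Module.finrank K L = 3) :
    (∃ x : L, x ≠ 0 ∧ Algebra.trace K L x = 1 ∧ Algebra.trace K L x⁻¹ = 1) ↔
      ringChar K = 2 := by
  constructor
  · rintro ⟨x, hx, h1, h2⟩
    have hcubic := Algebra.cubic_trace_trace_inv hdeg hx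
    rw [h1, h2, mul_one, one_smul, Algebra.smul_def, Algebra.smul_def, mul_one] at hcubic
    have hmul : (x - 1) * (x ^ 2 + algebraMap K L (Algebra.norm K x)) = 0 := by
      linear_combination hcubic
    have hmem : x ∈ (algebraMap K L).range := by
      rcases mul_eq_zero.mp hmul with h | h
      · exact ⟨1, by rw [map_one, sub_eq_zero.mp h]⟩
      · refine mem_range_algebraMap_of_sq_mem_of_odd_finrank (a := -Algebra.norm K x)
          (hdeg ▸ by decide) ?_
        rw [map_neg]
        exact eq_neg_of_add_eq_zero_left h
    obtain ⟨y, rfl⟩ := hmem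
    have hy : y ≠ 0 := by
      rintro rfl
      exact hx (map_zero _)
    rw [← map_inv₀, Algebra.trace_algebraMap, hdeg, nsmul_eq_mul] at h2
    rw [Algebra.trace_algebraMap, hdeg, nsmul_eq_mul] at h1
    push_cast at h1 h2
    have hpow : (2 : K) ^ 3 = 0 := by
      linear_combination (3 * y⁻¹) * h1 + h2 - 9 * mul_inv_cancel₀ hy
    have htwo : (2 : K) = 0 := eq_zero_of_pow_eq_zero hpow
    exact CharP.ringChar_of_prime_eq_zero Nat.prime_two (by exact_mod_cast htwo)
  · intro h
    have htwo : (2 : K) = 0 := by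
      have := ringChar.Nat.cast_ringChar (R := K)
      rw [h] at this
      exact_mod_cast this
    have htr : Algebra.trace K L 1 = 1 := by
      rw [← map_one (algebraMap K L), Algebra.trace_algebraMap, hdeg, nsmul_eq_mul]
      push_cast
      linear_combination htwo
    exact ⟨1, one_ne_zero, htr, by rwa [inv_one]⟩
end

section
/- Let K be a field with char(K) ≠ 2, let f = X⁴ + X² + d be an irreducible polynomial over K, let α be a root of f, and let L = K(α). Then T₀·T₀ = L; that is, every element of L can be written as a product x·y with x, y ∈ L and Tr(x) = Tr(y) = 0. -/
open Polynomial

/-- An element negated by a `K`-automorphism has trace zero when `2 ≠ 0`. -/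
theorem trace_eq_zero_of_algEquiv_eq_neg {K L : Type*} [Field K] [Field L] [Algebra K L]
    (h2 : (2 : K) ≠ 0) (σ : L ≃ₐ[K] L) {x : L} (hx : σ x = -x) : Algebra.trace K L x = 0 := by
  have h := Algebra.trace_eq_of_algEquiv σ x
  rw [hx, map_neg] at h
  have h' : 2 * Algebra.trace K L x = 0 := by linear_combination -h
  exact (mul_eq_zero.mp h').resolve_left h2

/-- A square root of an element of `K` that does not lie in `K` has trace zero. -/
theorem trace_eq_zero_of_sq_eq_algebraMap {K L : Type*} [Field K] [Field L] [Algebra K L]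
    [FiniteDimensional K L] {x : L} {a : K} (hx : x ^ 2 = algebraMap K L a)
    (hxK : ∀ c : K, x ≠ algebraMap K L c) : Algebra.trace K L x = 0 := by
  have hirr : Irreducible (X ^ 2 - C a : K[X]) := by
    refine X_pow_sub_C_irreducible_of_prime Nat.prime_two ?_
    rintro c rfl
    rw [map_pow, sq_eq_sq_iff_eq_or_eq_neg, ← map_neg] at hx
    exact hx.elim (hxK c) (hxK (-c))
  have hmin : X ^ 2 - C a = minpoly K x :=
    minpoly.eq_of_irreducible_of_monic hirr (by simp [hx]) (monic_X_pow_sub_C a two_ne_zero)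
  have hnext : (X ^ 2 - C a : K[X]).nextCoeff = 0 := by
    rw [nextCoeff_of_natDegree_pos] <;> simp
  rw [trace_eq_finrank_mul_minpoly_nextCoeff, ← hmin, hnext, neg_zero, mul_zero]

/-- If `α` generates `L` over `K` and its minimal polynomial vanishes at `-α`, then some involutive
`K`-automorphism of `L` sends `α` to `-α`. -/
theorem exists_algEquiv_apply_eq_neg {K L : Type*} [Field K] [Field L] [Algebra K L]
    [FiniteDimensional K L] {α : L} (hgen : Algebra.adjoin K {α} = ⊤)
    (hα : aeval (-α) (minpoly K α) = 0) :
    ∃ σ : L ≃ₐ[K] L, σ α = -α ∧ ∀ x, σ (σ x) = x := by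
  let pb := PowerBasis.ofAdjoinEqTop (Algebra.IsIntegral.isIntegral (R := K) α) hgen
  have hpb : pb.gen = α := PowerBasis.ofAdjoinEqTop_gen _ _
  let τ : L →ₐ[K] L := pb.lift (-α) (by rwa [hpb])
  have hτ : τ α = -α := by
    simpa only [hpb] using (pb.lift_gen (-α) (by rwa [hpb]) : τ pb.gen = -α)
  have hττ : τ.comp τ = AlgHom.id K L :=
    AlgHom.ext_of_adjoin_eq_top hgen (by simp [hτ])
  exact ⟨AlgEquiv.ofAlgHom τ τ hττ hττ, hτ, fun x => DFunLike.congr_fun hττ x⟩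

/-- For a quartic extension L = K(α), char K ≠ 2, α a root of the irreducible
polynomial X⁴ + X² + d: T₀·T₀ = L. -/
theorem stmt_13 (K L : Type*) [Field K] [Field L] [Algebra K L] [FiniteDimensional K L]
    (hchar : ringChar K ≠ 2) (d : K)
    (hirr : Irreducible (X ^ 4 + X ^ 2 + C d : K[X]))
    (α : L) (hroot : Polynomial.aeval α (X ^ 4 + X ^ 2 + C d : K[X]) = 0)
    (hgen : Algebra.adjoin K {α} = ⊤) :
    ∀ β : L, ∃ x y : L,
      Algebra.trace K L x = 0 ∧ Algebra.trace K L y = 0 ∧ β = x * y := by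
  intro β
  have h2 : (2 : K) ≠ 0 := Ring.two_ne_zero hchar
  have h2L : (2 : L) ≠ 0 := by
    rw [← map_ofNat (algebraMap K L) 2]
    exact (_root_.map_ne_zero _).mpr h2
  have hdeg : (X ^ 4 + X ^ 2 + C d : K[X]).natDegree = 4 := by compute_degree!
  have hmonic : (X ^ 4 + X ^ 2 + C d : K[X]).Monic := by monicity!
  have hmin := minpoly.eq_of_irreducible_of_monic hirr hroot hmonic
  obtain ⟨σ, hσα, hσσ⟩ := exists_algEquiv_apply_eq_neg hgen (by
    rw [← hmin]
    simpa [Even.neg_pow (by decide : Even 4)] using hroot)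
  have hαsq : ∀ c : K, α ^ 2 ≠ algebraMap K L c := by
    intro c hc
    have hle := natDegree_le_of_dvd
      (minpoly.dvd K α (p := X ^ 2 - C c) (by simp [hc])) (X_pow_sub_C_ne_zero two_pos c)
    rw [← hmin, hdeg, natDegree_X_pow_sub_C] at hle
    omega
  have hα0 : α ≠ 0 := fun h => hαsq 0 (by simp [h])
  set δ : L := 2 * α ^ 2 + 1 with hδ
  have hδK : ∀ c : K, δ ≠ algebraMap K L c := by
    intro c hc
    refine hαsq ((c - 1) / 2) ?_
    simp only [map_div₀, map_sub, map_one, map_ofNat, ← hc, hδ]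
    field_simp
    ring
  have hδ0 : δ ≠ 0 := fun h => hδK 0 (by simp [h])
  have hδtr : Algebra.trace K L δ = 0 := by
    refine trace_eq_zero_of_sq_eq_algebraMap (a := 1 - 4 * d) ?_ hδK
    simp only [map_add, map_pow, aeval_X, aeval_C] at hroot
    simp only [map_sub, map_mul, map_one, map_ofNat]
    linear_combination 4 * hroot
  have hσδ : σ δ = δ := by
    rw [hδ, map_add, map_mul, map_pow, map_ofNat, map_one, hσα, neg_sq]
  by_cases hβ : σ β = β
  · refine ⟨α, β / α, trace_eq_zero_of_algEquiv_eq_neg h2 σ hσα,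
      trace_eq_zero_of_algEquiv_eq_neg h2 σ ?_, by field_simp⟩
    rw [map_div₀, hβ, hσα, div_neg]
  · set w : L := β - σ β with hw
    have hw0 : w ≠ 0 := sub_ne_zero.mpr (Ne.symm hβ)
    have hσw : σ w = -w := by simp [hw, hσσ]
    refine ⟨w / (2 * δ), δ + δ * (β + σ β) / w,
      trace_eq_zero_of_algEquiv_eq_neg h2 σ ?_, ?_, ?_⟩
    · rw [map_div₀, map_mul, map_ofNat, hσδ, hσw, neg_div]
    · rw [map_add, hδtr, zero_add]
      refine trace_eq_zero_of_algEquiv_eq_neg h2 σ ?_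
      rw [map_div₀, map_mul, hσδ, map_add, hσw, hσσ, div_neg, add_comm (σ β)]
    · field_simp
      rw [hw]
      ring
end

section
/- Let K be a field with char(K) ≠ 2, let f = X⁴ − d be an irreducible polynomial over K, let α be a root of f, and let L = K(α). Then T₀·T₀ = L; that is, every element of L can be written as a product x·y with x, y ∈ L and Tr(x) = Tr(y) = 0. -/
open Polynomial

section PureQuartic

variable {K L : Type*} [Field K] [Field L] [Algebra K L]

/-- If `α` generates `L` over `K` and is a root of the irreducible polynomial `X ^ 4 - d`,
then `1, α, α ^ 2, α ^ 3` is a basis of `L` over `K`. -/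
theorem exists_basis_pow_of_irreducible_X_pow_four_sub_C [FiniteDimensional K L] {d : K}
    (hirr : Irreducible (X ^ 4 - C d : K[X])) {α : L}
    (hroot : aeval α (X ^ 4 - C d : K[X]) = 0) (hgen : Algebra.adjoin K {α} = ⊤) :
    ∃ b : Module.Basis (Fin 4) K L, ∀ i, b i = α ^ (i : ℕ) := by
  have hmin : minpoly K α = X ^ 4 - C d :=
    (minpoly.eq_of_irreducible_of_monic hirr hroot (monic_X_pow_sub_C d four_ne_zero)).symm
  let pb : PowerBasis K L := PowerBasis.ofAdjoinEqTop (IsIntegral.of_finite K α) hgen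
  have hpb : pb.gen = α := PowerBasis.ofAdjoinEqTop_gen _ _
  have hdim : pb.dim = 4 := by
    rw [← pb.natDegree_minpoly, hpb, hmin, natDegree_X_pow_sub_C]
  exact ⟨pb.basis.reindex (finCongr hdim), fun i => by simp [hpb]⟩

variable {d : K} {α : L} (b : Module.Basis (Fin 4) K L) (hb : ∀ i, b i = α ^ (i : ℕ))
  (hα : α ^ 4 = algebraMap K L d)

include hb hα

theorem trace_pow_eq_zero_of_pow_four_eq {k : ℕ} (hk0 : 0 < k) (hk4 : k < 4) :
    Algebra.trace K L (α ^ k) = 0 := by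
  classical
  rw [Algebra.trace_eq_matrix_trace b, Matrix.trace]
  refine Finset.sum_eq_zero fun i _ => ?_
  rw [Matrix.diag_apply, Algebra.leftMulMatrix_eq_repr_mul, hb, ← pow_add]
  rcases lt_or_ge (k + i) 4 with h | h
  · rw [show α ^ (k + (i : ℕ)) = b ⟨k + i, h⟩ from (hb ⟨k + i, h⟩).symm, b.repr_self,
      Finsupp.single_eq_of_ne]
    intro e
    have := congrArg Fin.val e
    simp only at this
    omega
  · have h4 : k + i - 4 < 4 := by omega
    have : α ^ (k + (i : ℕ)) = d • b ⟨k + i - 4, h4⟩ := by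
      rw [hb, Algebra.smul_def, ← hα, ← pow_add]
      congr 1
      simp only
      omega
    rw [this, map_smul, b.repr_self, Finsupp.smul_apply, Finsupp.single_eq_of_ne, smul_zero]
    intro e
    have := congrArg Fin.val e
    simp only at this
    omega

theorem trace_cubic_eq_zero_of_pow_four_eq (u v w : K) :
    Algebra.trace K L (u • α + v • α ^ 2 + w • α ^ 3) = 0 := by
  have h1 := trace_pow_eq_zero_of_pow_four_eq b hb hα (k := 1) (by simp) (by simp)
  rw [pow_one] at h1
  simp [h1, trace_pow_eq_zero_of_pow_four_eq b hb hα]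

omit hα in
theorem eq_zero_of_add_mul_sq_eq_zero {p r : K}
    (h : algebraMap K L p + algebraMap K L r * α ^ 2 = 0) : p = 0 ∧ r = 0 := by
  have hli := Fintype.linearIndependent_iff.1 b.linearIndependent ![p, 0, r, 0]
    (by simpa [Fin.sum_univ_four, hb, Algebra.smul_def] using h)
  exact ⟨hli 0, hli 2⟩

end PureQuartic

/-- For a quartic extension L = K(α), char K ≠ 2, α a root of the irreducible
polynomial X⁴ − d: T₀·T₀ = L. -/
theorem stmt_14 (K L : Type*) [Field K] [Field L] [Algebra K L] [FiniteDimensional K L]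
    (hchar : ringChar K ≠ 2) (d : K)
    (hirr : Irreducible (X ^ 4 - C d : K[X]))
    (α : L) (hroot : Polynomial.aeval α (X ^ 4 - C d : K[X]) = 0)
    (hgen : Algebra.adjoin K {α} = ⊤) :
    ∀ β : L, ∃ x y : L,
      Algebra.trace K L x = 0 ∧ Algebra.trace K L y = 0 ∧ β = x * y := by
  intro β
  obtain ⟨b, hb⟩ := exists_basis_pow_of_irreducible_X_pow_four_sub_C hirr hroot hgen
  have hα : α ^ 4 = algebraMap K L d := by simpa [sub_eq_zero] using hroot
  have hα0 : α ≠ 0 := fun h => b.ne_zero 1 (by simp [hb, h])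
  obtain ⟨g, hg⟩ : ∃ g : Fin 4 → K, β / α = g 0 • 1 + g 1 • α + g 2 • α ^ 2 + g 3 • α ^ 3 :=
    ⟨b.repr (β / α), by simpa [Fin.sum_univ_four, hb] using (b.sum_repr (β / α)).symm⟩
  -- The constant coefficient of `β / α * (p - r * α ^ 2)` is `g 0 * p - d * g 2 * r`.
  obtain ⟨p, r, hpr, hne⟩ : ∃ p r : K, g 0 * p = d * g 2 * r ∧ ¬(p = 0 ∧ r = 0) := by
    by_cases h : d * g 2 = 0 ∧ g 0 = 0
    · exact ⟨1, 0, by simp [h.2], by simp⟩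
    · exact ⟨d * g 2, g 0, mul_comm _ _, h⟩
  have hplus : algebraMap K L p + algebraMap K L r * α ^ 2 ≠ 0 :=
    fun h => hne (eq_zero_of_add_mul_sq_eq_zero b hb h)
  have hminus : algebraMap K L p - algebraMap K L r * α ^ 2 ≠ 0 := fun h => hne <| by
    simpa using eq_zero_of_add_mul_sq_eq_zero b hb (p := p) (r := -r)
      (by rw [map_neg]; linear_combination h)
  have hnorm : algebraMap K L (p ^ 2 - d * r ^ 2) =
      (algebraMap K L p + algebraMap K L r * α ^ 2) *
        (algebraMap K L p - algebraMap K L r * α ^ 2) := by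
    simp only [map_sub, map_mul, map_pow]
    linear_combination (algebraMap K L r) ^ 2 * hα
  have hn : algebraMap K L (p ^ 2 - d * r ^ 2) ≠ 0 := hnorm ▸ mul_ne_zero hplus hminus
  refine ⟨α * (algebraMap K L p + algebraMap K L r * α ^ 2),
    (p ^ 2 - d * r ^ 2)⁻¹ • (β / α * (algebraMap K L p - algebraMap K L r * α ^ 2)), ?_, ?_, ?_⟩
  · convert trace_cubic_eq_zero_of_pow_four_eq b hb hα p 0 r using 2
    simp only [Algebra.smul_def, map_zero]
    ring
  · rw [map_smul, smul_eq_zero]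
    right
    convert trace_cubic_eq_zero_of_pow_four_eq b hb hα
      (g 1 * p - d * g 3 * r) (g 2 * p - g 0 * r) (g 3 * p - g 1 * r) using 2
    have hpr' := congrArg (algebraMap K L) hpr
    simp only [map_mul] at hpr'
    rw [hg]
    simp only [Algebra.smul_def, map_sub, map_mul]
    linear_combination hpr' - (algebraMap K L (g 2) * algebraMap K L r +
      algebraMap K L (g 3) * algebraMap K L r * α) * hα
  · rw [Algebra.smul_def, map_inv₀]
    field_simp
    rw [hnorm]
    ring
end

section
/- Let K be a field with char(K) ≠ 2, let f = X⁴ − d be an irreducible polynomial over K, let α be a root of f, and let L = K(α). Then T₀·T₁ = L; that is, every element of L can be written as a product x·y with x, y ∈ L, Tr(x) = 0 and Tr(y) = 1. -/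
open Polynomial

/-- If the powers `1, α, α², α³` form a basis and `α ^ 4` is the scalar `d`, then the trace of an
element is four times its constant coordinate. -/
theorem Algebra.trace_eq_four_mul_of_pow_four_eq {K L : Type*} [Field K] [Field L] [Algebra K L]
    (b : Module.Basis (Fin 4) K L) {d : K} {α : L} (hb : ∀ i, b i = α ^ (i : ℕ))
    (hα : α ^ 4 = algebraMap K L d) (c₀ c₁ c₂ c₃ : K) :
    Algebra.trace K L (c₀ • (1 : L) + c₁ • α + c₂ • α ^ 2 + c₃ • α ^ 3) = 4 * c₀ := by
  have hM : Algebra.leftMulMatrix b α = !![0, 0, 0, d; 1, 0, 0, 0; 0, 1, 0, 0; 0, 0, 1, 0] := by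
    have h0 : α * b 0 = b 1 := by simp [hb]
    have h1 : α * b 1 = b 2 := by simp [hb]; ring
    have h2 : α * b 2 = b 3 := by simp [hb]; ring
    have h3 : α * b 3 = d • b 0 := by
      have : α * α ^ 3 = α ^ 4 := by ring
      simp [hb, this, hα, Algebra.smul_def]
    ext i j
    rw [Algebra.leftMulMatrix_eq_repr_mul]
    fin_cases j <;> simp only [Fin.zero_eta, Fin.mk_one, Fin.reduceFinMk, h0, h1, h2, h3] <;>
      fin_cases i <;> simp
  rw [Algebra.trace_eq_matrix_trace b]
  simp only [map_add, map_smul, map_one, map_mul, hM, pow_succ, pow_zero, one_mul]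
  simp [Matrix.trace, Fin.sum_univ_four]
  ring

/-- Rescaling a factorization `β = x * y` with `x` of trace zero and `y` of nonzero trace. -/
theorem Algebra.exists_trace_eq_zero_trace_eq_one {K L : Type*} [Field K] [Field L] [Algebra K L]
    {β : L} (x y : L) (hx : Algebra.trace K L x = 0) (hy : Algebra.trace K L y ≠ 0)
    (h : β = x * y) :
    ∃ x y : L, Algebra.trace K L x = 0 ∧ Algebra.trace K L y = 1 ∧ β = x * y :=
  ⟨Algebra.trace K L y • x, (Algebra.trace K L y)⁻¹ • y, by simp [hx], by simp [hy], by
    rw [smul_mul_smul_comm, mul_inv_cancel₀ hy, one_smul, h]⟩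

/-- For a quartic extension L = K(α), char K ≠ 2, α a root of the irreducible
polynomial X⁴ − d: T₀·T₁ = L. -/
theorem stmt_15 (K L : Type*) [Field K] [Field L] [Algebra K L] [FiniteDimensional K L]
    (hchar : ringChar K ≠ 2) (d : K)
    (hirr : Irreducible (X ^ 4 - C d : K[X]))
    (α : L) (hroot : Polynomial.aeval α (X ^ 4 - C d : K[X]) = 0)
    (hgen : Algebra.adjoin K {α} = ⊤) :
    ∀ β : L, ∃ x y : L,
      Algebra.trace K L x = 0 ∧ Algebra.trace K L y = 1 ∧ β = x * y := by
  have h2 : (2 : K) ≠ 0 := Ring.two_ne_zero hchar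
  have h4 : (4 : K) ≠ 0 := by
    rw [show (4 : K) = 2 * 2 by norm_num]
    exact mul_ne_zero h2 h2
  have hdeg : (X ^ 4 - C d : K[X]).natDegree = 4 := natDegree_X_pow_sub_C
  have hne (r : K) : r ^ 4 ≠ d := fun hr => by
    have h1 : (X ^ 4 - C d : K[X]).natDegree = 1 := natDegree_eq_of_degree_eq_some
      (degree_eq_one_of_irreducible_of_root hirr (x := r) (by simp [hr]))
    omega
  have hd0 : d ≠ 0 := fun h => hne 0 (by simp [h])
  have hd1 : 1 - d ≠ 0 := fun h => hne 1 (by rw [one_pow]; exact sub_eq_zero.mp h)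
  have hα : α ^ 4 = algebraMap K L d := by simpa [sub_eq_zero] using hroot
  have hint : IsIntegral K α := IsIntegral.of_finite K α
  have hmin : X ^ 4 - C d = minpoly K α :=
    minpoly.eq_of_irreducible_of_monic hirr hroot (monic_X_pow_sub_C d (by norm_num))
  let pb := PowerBasis.ofAdjoinEqTop hint hgen
  have hgenα : pb.gen = α := PowerBasis.ofAdjoinEqTop_gen hint hgen
  have hdim : pb.dim = 4 := by rw [← pb.natDegree_minpoly, hgenα, ← hmin, hdeg]
  let b := pb.basis.reindex (finCongr hdim)
  have hb (i : Fin 4) : b i = α ^ (i : ℕ) := by simp [b, hgenα]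
  have htr := Algebra.trace_eq_four_mul_of_pow_four_eq b hb hα
  have hd0' : algebraMap K L d ≠ 0 := by simpa using hd0
  have hd1' : 1 - algebraMap K L d ≠ 0 := by
    rw [← map_one (algebraMap K L), ← map_sub]
    exact (_root_.map_ne_zero _).mpr hd1
  intro β
  obtain ⟨c₀, c₁, c₂, c₃, rfl⟩ : ∃ c₀ c₁ c₂ c₃ : K,
      β = c₀ • (1 : L) + c₁ • α + c₂ • α ^ 2 + c₃ • α ^ 3 :=
    ⟨b.repr β 0, b.repr β 1, b.repr β 2, b.repr β 3, by
      conv_lhs => rw [← b.sum_repr β]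
      simp [Fin.sum_univ_four, hb]⟩
  by_cases h₁ : c₁ = 0
  · by_cases h₂ : c₂ = 0
    · by_cases h₃ : c₃ = 0
      · by_cases h₀ : c₀ = 0
        · refine ⟨0, (4 : K)⁻¹ • (1 : L) + (0 : K) • α + (0 : K) • α ^ 2 + (0 : K) • α ^ 3,
            by simp, by rw [htr, mul_inv_cancel₀ h4], by simp [h₀, h₁, h₂, h₃]⟩
        · refine Algebra.exists_trace_eq_zero_trace_eq_one (α + α ^ 2)
            ((-c₀ / (1 - d)) • (1 : L) + (c₀ / (1 - d)) • α + (-c₀ / (1 - d)) • α ^ 2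
              + (c₀ / (d * (1 - d))) • α ^ 3)
            (by simpa using htr 0 1 1 0) (by rw [htr]; simp [h4, h₀, hd1]) ?_
          simp only [h₁, h₂, h₃, Algebra.smul_def, map_div₀, map_neg, map_mul, map_sub, map_one,
            map_zero]
          field_simp
          linear_combination (-algebraMap K L c₀ * (1 - algebraMap K L d + α)) * hα
      · refine Algebra.exists_trace_eq_zero_trace_eq_one (α ^ 3)
          (c₃ • (1 : L) + (c₀ / d) • α + (c₁ / d) • α ^ 2 + (c₂ / d) • α ^ 3)
          (by simpa using htr 0 0 0 1) (by rw [htr]; exact mul_ne_zero h4 h₃) ?_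
        simp only [Algebra.smul_def, map_div₀]
        field_simp
        linear_combination (-algebraMap K L c₀ - algebraMap K L c₁ * α
          - algebraMap K L c₂ * α ^ 2) * hα
    · refine Algebra.exists_trace_eq_zero_trace_eq_one (α ^ 2)
        (c₂ • (1 : L) + c₃ • α + (c₀ / d) • α ^ 2 + (c₁ / d) • α ^ 3)
        (by simpa using htr 0 0 1 0) (by rw [htr]; exact mul_ne_zero h4 h₂) ?_
      simp only [Algebra.smul_def, map_div₀]
      field_simp
      linear_combination (-algebraMap K L c₀ - algebraMap K L c₁ * α) * hα
  · refine Algebra.exists_trace_eq_zero_trace_eq_one α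
      (c₁ • (1 : L) + c₂ • α + c₃ • α ^ 2 + (c₀ / d) • α ^ 3)
      (by simpa using htr 0 1 0 0) (by rw [htr]; exact mul_ne_zero h4 h₁) ?_
    simp only [Algebra.smul_def, map_div₀]
    field_simp
    linear_combination (-algebraMap K L c₀) * hα
end

section
/- Let K be a field with char(K) ≠ 2 and let L be a field extension of K with [L:K] = 4. Then 1 ∈ T₀·T₀ (i.e. there exists x ∈ L with x ≠ 0, Tr(x) = 0 and Tr(x⁻¹) = 0) if and only if L has a quadratic subfield, that is, there exists an intermediate field E with K ⊆ E ⊆ L and [E:K] = 2. -/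
open Polynomial IntermediateField

section

variable {K L : Type*} [Field K] [Field L] [Algebra K L]

/-- A cubic relation satisfied by an element of degree 4 is trivial. -/
theorem eq_zero_of_cubic_relation {x : L} (hx : (minpoly K x).natDegree = 4) {p q r s : K}
    (h : algebraMap K L p * x ^ 3 + algebraMap K L q * x ^ 2 + algebraMap K L r * x
      + algebraMap K L s = 0) : p = 0 ∧ q = 0 ∧ r = 0 ∧ s = 0 := by
  have hP : C p * X ^ 3 + C q * X ^ 2 + C r * X + C s = 0 := by
    by_contra hne
    have h1 := natDegree_le_of_dvd (minpoly.dvd K x (by simpa using h)) hne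
    have h2 : (C p * X ^ 3 + C q * X ^ 2 + C r * X + C s).natDegree ≤ 3 :=
      natDegree_cubic_le
    omega
  refine ⟨?_, ?_, ?_, ?_⟩
  · simpa [coeff_X, coeff_C, coeff_X_pow] using congrArg (fun P => P.coeff 3) hP
  · simpa [coeff_X, coeff_C, coeff_X_pow] using congrArg (fun P => P.coeff 2) hP
  · simpa [coeff_X, coeff_C, coeff_X_pow] using congrArg (fun P => P.coeff 1) hP
  · simpa [coeff_X, coeff_C, coeff_X_pow] using congrArg (fun P => P.coeff 0) hP

variable [FiniteDimensional K L]

/-- An element of degree 4 and trace zero in a quartic extension is a root of a depressed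
quartic. -/
theorem exists_depressed_quartic (hdeg : Module.finrank K L = 4) {x : L}
    (hx : (minpoly K x).natDegree = 4) (ht : Algebra.trace K L x = 0) :
    ∃ b c d : K, x ^ 4 + algebraMap K L b * x ^ 2 + algebraMap K L c * x
      + algebraMap K L d = 0 := by
  have hint : IsIntegral K x := IsIntegral.of_finite K x
  have hrank : Module.finrank K⟮x⟯ L = 1 := by
    have h := Module.finrank_mul_finrank K K⟮x⟯ L
    rw [adjoin.finrank hint, hx, hdeg] at h
    omega
  have hcoeff : (minpoly K x).coeff 3 = 0 := by
    rw [trace_eq_finrank_mul_minpoly_nextCoeff, hrank,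
      nextCoeff_of_natDegree_pos (by omega), hx] at ht
    simpa using ht
  have hlead : (minpoly K x).coeff 4 = 1 := by
    have h := (minpoly.monic hint).coeff_natDegree
    rwa [hx] at h
  refine ⟨(minpoly K x).coeff 2, (minpoly K x).coeff 1, (minpoly K x).coeff 0, ?_⟩
  have h := minpoly.aeval K x
  rw [aeval_eq_sum_range, hx] at h
  simp only [Finset.sum_range_succ, Finset.sum_range_zero, hcoeff, hlead,
    Algebra.smul_def, map_zero, map_one] at h
  linear_combination h

/-- If an element of degree 4 is a root of a biquadratic polynomial, its square generates a
quadratic subfield. -/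
theorem finrank_adjoin_sq_eq_two {x : L} (hx : (minpoly K x).natDegree = 4) {b d : K}
    (h : x ^ 4 + algebraMap K L b * x ^ 2 + algebraMap K L d = 0) :
    Module.finrank K K⟮x ^ 2⟯ = 2 := by
  have hint : IsIntegral K (x ^ 2) := IsIntegral.of_finite K _
  rw [adjoin.finrank hint]
  have hdeg : (C 1 * X ^ 2 + C b * X + C d : K[X]).natDegree = 2 :=
    natDegree_quadratic one_ne_zero
  have hle : (minpoly K (x ^ 2)).natDegree ≤ 2 := by
    refine (natDegree_le_of_dvd (minpoly.dvd K _ ?_)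
      (ne_zero_of_natDegree_gt (n := 0) (by rw [hdeg]; norm_num))).trans_eq hdeg
    simp only [map_add, map_mul, aeval_C, aeval_X, map_pow, map_one]
    linear_combination h
  have hne : (minpoly K (x ^ 2)).natDegree ≠ 1 := by
    intro h1
    obtain ⟨a, ha⟩ := minpoly.natDegree_eq_one_iff.mp h1
    have h2 := eq_zero_of_cubic_relation hx (p := 0) (q := 1) (r := 0) (s := -a)
      (by simp [ha])
    exact one_ne_zero h2.2.1
  have := minpoly.natDegree_pos hint
  omega

/-- An element outside `K` with square in `K` has trace zero. -/
theorem trace_eq_zero_of_sq_mem {x : L} {d : K} (hx : x ∉ (algebraMap K L).range)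
    (h : x ^ 2 = algebraMap K L d) : Algebra.trace K L x = 0 := by
  have hint : IsIntegral K x := IsIntegral.of_finite K x
  have hmin : X ^ 2 - C d = minpoly K x := by
    refine minpoly.unique' K x (monic_X_pow_sub_C d two_ne_zero) (by simp [h]) ?_
    intro q hq
    by_cases hq0 : q = 0
    · exact Or.inl hq0
    · refine Or.inr fun hr => hx ?_
      rw [degree_X_pow_sub_C (by norm_num)] at hq
      have h1 := natDegree_le_of_dvd (minpoly.dvd K x hr) hq0
      have h2 : q.natDegree < 2 := (natDegree_lt_iff_degree_lt hq0).mpr (by exact_mod_cast hq)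
      have := minpoly.natDegree_pos hint
      exact minpoly.natDegree_eq_one_iff.mp (by omega)
  rw [trace_eq_finrank_mul_minpoly_nextCoeff, ← hmin,
    nextCoeff_of_natDegree_pos (by rw [natDegree_X_pow_sub_C]; norm_num), natDegree_X_pow_sub_C]
  simp [coeff_X_pow]

/-- In characteristic not 2, an extension with a quadratic subfield contains a square root,
outside `K`, of an element of `K`. -/
theorem exists_sq_mem_of_finrank_eq_two (h2 : (2 : K) ≠ 0) {E : IntermediateField K L}
    (hE : Module.finrank K E = 2) :
    ∃ (x : L) (d : K), x ∉ (algebraMap K L).range ∧ x ^ 2 = algebraMap K L d := by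
  have hbot : E ≠ ⊥ := by
    rintro rfl
    simp at hE
  obtain ⟨y, hyE, hy⟩ : ∃ y ∈ E, y ∉ (algebraMap K L).range := by
    by_contra! hall
    exact hbot (le_bot_iff.mp fun z hz => mem_bot.mpr (hall z hz))
  have hint : IsIntegral K y := IsIntegral.of_finite K y
  have hle : (minpoly K y).natDegree ≤ 2 := by
    rw [← hE, ← adjoin.finrank hint]
    exact finrank_le_of_le_right (adjoin_simple_le_iff.mpr hyE)
  have hdeg : (minpoly K y).natDegree = 2 := by
    have h1 : (minpoly K y).natDegree ≠ 1 := fun h => hy (minpoly.natDegree_eq_one_iff.mp h)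
    have := minpoly.natDegree_pos hint
    omega
  have hlead : (minpoly K y).coeff 2 = 1 := by
    have h := (minpoly.monic hint).coeff_natDegree
    rwa [hdeg] at h
  have h := minpoly.aeval K y
  rw [aeval_eq_sum_range, hdeg] at h
  simp only [Finset.sum_range_succ, Finset.sum_range_zero, hlead, Algebra.smul_def, map_one] at h
  set b := (minpoly K y).coeff 1
  set c := (minpoly K y).coeff 0
  refine ⟨algebraMap K L 2 * y + algebraMap K L b, b ^ 2 - 4 * c, ?_, ?_⟩
  · rintro ⟨a, ha⟩
    refine hy ⟨(a - b) / 2, ?_⟩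
    have h2L : algebraMap K L 2 ≠ 0 := by simpa using h2
    rw [map_div₀, map_sub, ha]
    field_simp
    ring
  · simp only [map_sub, map_mul, map_pow, map_ofNat]
    linear_combination 4 * h

end

theorem stmt_16 (K L : Type*) [Field K] [Field L] [Algebra K L] [FiniteDimensional K L]
    (hchar : ringChar K ≠ 2) (hdeg : Module.finrank K L = 4) :
    (∃ x : L, x ≠ 0 ∧ Algebra.trace K L x = 0 ∧ Algebra.trace K L x⁻¹ = 0) ↔
      (∃ E : IntermediateField K L, Module.finrank K E = 2) := by
  have h2 : (2 : K) ≠ 0 := Ring.two_ne_zero hchar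
  constructor
  · rintro ⟨x, hx0, htx, hty⟩
    have hint : IsIntegral K x := IsIntegral.of_finite K x
    have hdvd : (minpoly K x).natDegree ∣ 2 ^ 2 := by
      rw [← adjoin.finrank hint, show 2 ^ 2 = 4 by norm_num, ← hdeg]
      exact ⟨_, (Module.finrank_mul_finrank K K⟮x⟯ L).symm⟩
    obtain ⟨k, hk, hxk⟩ := (Nat.dvd_prime_pow Nat.prime_two).mp hdvd
    interval_cases k
    · obtain ⟨a, rfl⟩ := minpoly.natDegree_eq_one_iff.mp hxk
      rw [Algebra.trace_algebraMap, hdeg, nsmul_eq_mul] at htx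
      have h4 : ((4 : ℕ) : K) ≠ 0 := by
        rw [show ((4 : ℕ) : K) = 2 * 2 by norm_num]
        exact mul_ne_zero h2 h2
      have ha : a = 0 := (mul_eq_zero.mp htx).resolve_left h4
      exact absurd (by simp [ha]) hx0
    · exact ⟨K⟮x⟯, by rw [adjoin.finrank hint, hxk]; norm_num⟩
    · have hx4 : (minpoly K x).natDegree = 4 := by rw [hxk]; norm_num
      have hy4 : (minpoly K x⁻¹).natDegree = 4 := by
        have hadj : K⟮x⁻¹⟯ = K⟮x⟯ := by
          apply le_antisymm <;> rw [adjoin_simple_le_iff]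
          · exact inv_mem (mem_adjoin_simple_self K x)
          · simpa using inv_mem (mem_adjoin_simple_self K x⁻¹)
        rw [← adjoin.finrank (IsIntegral.of_finite K x⁻¹), hadj, adjoin.finrank hint, hx4]
      obtain ⟨b, c, d, hx⟩ := exists_depressed_quartic hdeg hx4 htx
      obtain ⟨e, f, g, hy⟩ := exists_depressed_quartic hdeg hy4 hty
      have hy' : 1 + algebraMap K L e * x ^ 2 + algebraMap K L f * x ^ 3
          + algebraMap K L g * x ^ 4 = 0 := by
        field_simp at hy
        linear_combination hy
      obtain ⟨-, -, hgc, hgd⟩ := eq_zero_of_cubic_relation hx4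
        (p := f) (q := e - g * b) (r := -(g * c)) (s := 1 - g * d) (by
          simp only [map_sub, map_mul, map_neg, map_one]
          linear_combination hy' - algebraMap K L g * hx)
      have hg : g ≠ 0 := by
        rintro rfl
        simp at hgd
      have hc : c = 0 := by simpa [hg] using hgc
      refine ⟨K⟮x ^ 2⟯, finrank_adjoin_sq_eq_two hx4 (b := b) (d := d) ?_⟩
      simpa [hc] using hx
  · rintro ⟨E, hE⟩
    obtain ⟨x, d, hx, hxd⟩ := exists_sq_mem_of_finrank_eq_two h2 hE
    have hx0 : x ≠ 0 := by
      rintro rfl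
      exact hx (zero_mem _)
    refine ⟨x, hx0, trace_eq_zero_of_sq_mem hx hxd, trace_eq_zero_of_sq_mem (d := d⁻¹) ?_ ?_⟩
    · rintro ⟨a, ha⟩
      exact hx ⟨a⁻¹, by rw [map_inv₀, ha, inv_inv]⟩
    · rw [inv_pow, hxd, map_inv₀]
end

section
/- Let q be a prime power and n a positive integer with n ≥ 5, or with n = 4 and q ∈ {2, 3}. Let α be a nonzero element of F_{q^n} and let a, b ∈ F_q. Then α can be written as α = x·y where x, y ∈ F_{q^n}, Tr(x) = a and Tr(y) = b. -/
namespace KloostermanStepanov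

open Polynomial

section Curve

variable {F : Type*} [Field F]

/-- The polynomial `W ^ q - X ^ (q - 1) * W - (X ^ (q + 1) + α X ^ (q - 1) - e X ^ q)` in `F[X][W]`,
whose zeros with `x ≠ 0` are the points `w = x * y` with `y ^ q - y = x + α / x - e`. -/
noncomputable def curvePoly (q : ℕ) (α e : F) : F[X][X] :=
  X ^ q - (C (X ^ (q - 1)) * X + C (X ^ (q + 1) + C α * X ^ (q - 1) - C e * X ^ q))

/-- The monomial `X ^ i * W ^ j` in `F[X][W]`. -/
noncomputable def bimon (F : Type*) [Field F] (i j : ℕ) : F[X][X] := C (X ^ i) * X ^ j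

lemma coeff_coeff_bimon (i j a b : ℕ) :
    ((bimon F i j).coeff b).coeff a = if a = i ∧ b = j then 1 else 0 := by
  simp only [bimon, coeff_C_mul, coeff_X_pow]
  by_cases hb : b = j <;> by_cases ha : a = i <;> simp [ha, hb, coeff_X_pow]

lemma degree_curvePoly_tail_lt {q : ℕ} (hq : 2 ≤ q) (α e : F) :
    (C (X ^ (q - 1)) * X + C (X ^ (q + 1) + C α * X ^ (q - 1) - C e * X ^ q) : F[X][X]).degree
      < q := by
  refine lt_of_le_of_lt degree_linear_le ?_
  exact_mod_cast (by omega : 1 < q)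

lemma curvePoly_monic {q : ℕ} (hq : 2 ≤ q) (α e : F) : (curvePoly q α e).Monic :=
  monic_X_pow_sub (by
    have := degree_curvePoly_tail_lt hq α e
    exact this)

lemma curvePoly_degree {q : ℕ} (hq : 2 ≤ q) (α e : F) : (curvePoly q α e).degree = q := by
  rw [curvePoly, degree_sub_eq_left_of_degree_lt]
  · simp
  · simpa using degree_curvePoly_tail_lt hq α e

/-- Every monomial has a reduced representative modulo the curve, with the same leading weight,
where `X` has weight `q` and `W` has weight `q + 1`. -/
lemma exists_reduced_bimon {q : ℕ} (hq : 2 ≤ q) (α e : F) (j : ℕ) : ∀ i : ℕ, ∃ g : F[X][X],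
    curvePoly q α e ∣ bimon F i j - g ∧ g.degree < q ∧
    (g.coeff (j % q)).coeff (i + (q + 1) * (j / q)) = 1 ∧
    ∀ a b, (g.coeff b).coeff a ≠ 0 → (a = i + (q + 1) * (j / q) ∧ b = j % q) ∨
      q * a + (q + 1) * b < q * i + (q + 1) * j := by
  induction j using Nat.strong_induction_on with
  | _ j ih =>
  intro i
  rcases lt_or_ge j q with hj | hj
  · refine ⟨bimon F i j, by simp, ?_, ?_, ?_⟩
    · refine lt_of_le_of_lt (degree_C_mul_X_pow_le _ _) (by exact_mod_cast hj)
    · simp [coeff_coeff_bimon, Nat.mod_eq_of_lt hj, Nat.div_eq_of_lt hj]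
    · intro a b hab
      rw [coeff_coeff_bimon] at hab
      left
      simpa [Nat.mod_eq_of_lt hj, Nat.div_eq_of_lt hj] using hab
  · obtain ⟨k, rfl⟩ := Nat.exists_eq_add_of_le' hj
    have hw : ∀ i' j' : ℕ, q * i' + (q + 1) * j' < q * i + (q + 1) * (k + q) → ∀ g : F[X][X],
        (∀ a b, (g.coeff b).coeff a ≠ 0 → (a = i' + (q + 1) * (j' / q) ∧ b = j' % q) ∨
          q * a + (q + 1) * b < q * i' + (q + 1) * j') →
        ∀ a b, q * i + (q + 1) * (k + q) ≤ q * a + (q + 1) * b → (g.coeff b).coeff a = 0 := by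
      intro i' j' h g hg a b hab
      by_contra hne
      rcases hg a b hne with ⟨rfl, rfl⟩ | h'
      · have h1 := Nat.div_add_mod j' q
        have : q * (i' + (q + 1) * (j' / q)) + (q + 1) * (j' % q) = q * i' + (q + 1) * j' := by
          conv_rhs => rw [← h1]
          ring
        omega
      · omega
    obtain ⟨r, rfl⟩ := Nat.exists_eq_add_of_le' hq
    obtain ⟨g₁, d₁, l₁, t₁, w₁⟩ := ih k (by omega) (i + (r + 2) + 1)
    obtain ⟨g₂, d₂, l₂, -, w₂⟩ := ih (k + 1) (by omega) (i + (r + 1))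
    obtain ⟨g₃, d₃, l₃, -, w₃⟩ := ih k (by omega) (i + (r + 1))
    obtain ⟨g₄, d₄, l₄, -, w₄⟩ := ih k (by omega) (i + (r + 2))
    have z₂ := hw _ _ (by ring_nf; omega) g₂ w₂
    have z₃ := hw _ _ (by ring_nf; omega) g₃ w₃
    have z₄ := hw _ _ (by ring_nf; omega) g₄ w₄
    have hdiv : (k + (r + 2)) / (r + 2) = k / (r + 2) + 1 := Nat.add_div_right _ (by omega)
    have hmod : (k + (r + 2)) % (r + 2) = k % (r + 2) := by simp
    have hpos : i + (r + 2 + 1) * ((k + (r + 2)) / (r + 2)) =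
        i + (r + 2) + 1 + (r + 2 + 1) * (k / (r + 2)) := by rw [hdiv]; ring
    have hco : ∀ a b, ((g₁ + g₂ + C (C α) * g₃ - C (C e) * g₄).coeff b).coeff a =
        (g₁.coeff b).coeff a + (g₂.coeff b).coeff a + α * (g₃.coeff b).coeff a
          - e * (g₄.coeff b).coeff a := by
      intro a b; simp
    refine ⟨g₁ + g₂ + C (C α) * g₃ - C (C e) * g₄, ?_, ?_, ?_, ?_⟩
    · have : bimon F i (k + (r + 2)) - (g₁ + g₂ + C (C α) * g₃ - C (C e) * g₄) =
          bimon F i k * curvePoly (r + 2) α e + (bimon F (i + (r + 2) + 1) k - g₁)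
          + (bimon F (i + (r + 1)) (k + 1) - g₂) + C (C α) * (bimon F (i + (r + 1)) k - g₃)
          - C (C e) * (bimon F (i + (r + 2)) k - g₄) := by
        simp only [bimon, curvePoly, map_add, map_sub, map_mul, map_pow,
          show r + 2 - 1 = r + 1 by omega]
        ring
      rw [this]
      exact dvd_sub (dvd_add (dvd_add (dvd_add (dvd_mul_left _ _) d₁) d₂)
        (dvd_mul_of_dvd_right d₃ _)) (dvd_mul_of_dvd_right d₄ _)
    · rw [← mem_degreeLT] at *
      refine sub_mem (add_mem (add_mem l₁ l₂) ?_) ?_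
      · rw [← smul_eq_C_mul]; exact Submodule.smul_mem _ _ l₃
      · rw [← smul_eq_C_mul]; exact Submodule.smul_mem _ _ l₄
    · have hwt : (r + 2) * i + (r + 2 + 1) * (k + (r + 2)) ≤
          (r + 2) * (i + (r + 2) + 1 + (r + 2 + 1) * (k / (r + 2))) +
          (r + 2 + 1) * (k % (r + 2)) := by
        have h1 := Nat.div_add_mod k (r + 2)
        conv_lhs => rw [← h1]
        apply le_of_eq
        ring
      rw [hmod, hpos, hco, t₁, z₂ _ _ hwt, z₃ _ _ hwt, z₄ _ _ hwt]
      ring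
    · intro a b hne
      by_contra! hcon
      rw [hmod, hpos] at hcon
      apply hne
      rw [hco, z₂ _ _ hcon.2, z₃ _ _ hcon.2, z₄ _ _ hcon.2]
      have : (g₁.coeff b).coeff a = 0 := by
        by_contra h1
        rcases w₁ a b h1 with h | h
        · exact hcon.1 h.1 h.2
        · have := hcon.2
          ring_nf at this h
          omega
      rw [this]
      ring

lemma eq_zero_of_curvePoly_dvd {q : ℕ} (hq : 2 ≤ q) {α e : F} {g : F[X][X]}
    (hd : curvePoly q α e ∣ g) (hg : g.degree < q) : g = 0 := by
  by_contra h
  exact (curvePoly_monic hq α e).not_dvd_of_degree_lt h (by rwa [curvePoly_degree hq]) hd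

/-- Monomials of pairwise distinct weights are linearly independent modulo the curve. -/
lemma eq_zero_of_dvd_sum_bimon {q : ℕ} (hq : 2 ≤ q) {α e : F} {ι : Type*} [Fintype ι]
    (u v : ι → ℕ) (hinj : Function.Injective fun I => q * u I + (q + 1) * v I) (a : ι → F)
    (hd : curvePoly q α e ∣ ∑ I, C (C (a I)) * bimon F (u I) (v I)) : a = 0 := by
  classical
  choose g hgd hgl hgt hgw using fun I => exists_reduced_bimon hq α e (v I) (u I)
  have hsum : ∑ I, C (C (a I)) * g I = 0 := by
    refine eq_zero_of_curvePoly_dvd hq (α := α) (e := e) ?_ ?_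
    · have : ∑ I, C (C (a I)) * g I = ∑ I, C (C (a I)) * bimon F (u I) (v I) -
          ∑ I, C (C (a I)) * (bimon F (u I) (v I) - g I) := by
        rw [← Finset.sum_sub_distrib]
        exact Finset.sum_congr rfl fun I _ => by ring
      rw [this]
      exact dvd_sub hd (Finset.dvd_sum fun I _ => dvd_mul_of_dvd_right (hgd I) _)
    · simp only [← mem_degreeLT] at *
      refine sum_mem fun I _ => ?_
      rw [← smul_eq_C_mul]
      exact Submodule.smul_mem _ _ (hgl I)
  by_contra hne
  obtain ⟨I₀, hI₀⟩ := Function.ne_iff.mp hne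
  obtain ⟨I, hI, hmax⟩ := (Finset.univ.filter fun I => a I ≠ 0).exists_max_image
    (fun I => q * u I + (q + 1) * v I) ⟨I₀, by simpa using hI₀⟩
  simp only [Finset.mem_filter, Finset.mem_univ, true_and] at hI hmax
  have hc := congrArg (fun f : F[X][X] =>
    (f.coeff (v I % q)).coeff (u I + (q + 1) * (v I / q))) hsum
  simp only [finsetSum_coeff, coeff_C_mul, coeff_zero] at hc
  rw [Finset.sum_eq_single I, hgt, mul_one] at hc
  · exact hI hc
  · intro J _ hJ
    by_contra h
    have haJ : a J ≠ 0 := fun h0 => h (by simp [h0])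
    have hle := hmax J haJ
    have hpos : ∀ K : ι, q * (u K + (q + 1) * (v K / q)) + (q + 1) * (v K % q) =
        q * u K + (q + 1) * v K := by
      intro K
      have h1 := Nat.div_add_mod (v K) q
      conv_rhs => rw [← h1]
      ring
    rcases hgw J _ _ (right_ne_zero_of_mul h) with ⟨h1, h2⟩ | h1
    · apply hJ
      apply hinj
      simp only
      rw [← hpos J, ← hpos I, h1, h2]
    · rw [hpos I] at h1
      omega
  · simp

lemma exists_reduced_bimon_of_weight_le {q : ℕ} (hq : 2 ≤ q) (α e : F) {u v D : ℕ}
    (hD : q * u + (q + 1) * v ≤ D) :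
    ∃ g : F[X][X], curvePoly q α e ∣ bimon F u v - g ∧ g.degree < q ∧
      ∀ a b, D < q * a → (g.coeff b).coeff a = 0 := by
  obtain ⟨g, hgd, hgl, -, hgw⟩ := exists_reduced_bimon hq α e v u
  refine ⟨g, hgd, hgl, fun a b hab => ?_⟩
  by_contra h
  rcases hgw a b h with ⟨h1, h3⟩ | h1
  · have h4 : q * a ≤ q * u + (q + 1) * v := by
      have h1' := Nat.div_add_mod v q
      rw [h1]
      conv_rhs => rw [← h1']
      nlinarith [Nat.zero_le ((q + 1) * (v % q))]
    omega
  · have : 0 ≤ (q + 1) * b := Nat.zero_le _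
    omega

/-- Sufficiently many monomials of bounded weight are linearly dependent modulo the curve. -/
lemma exists_dvd_sum_bimon {q : ℕ} (hq : 2 ≤ q) (α e : F) {ι : Type*} [Fintype ι]
    (u v : ι → ℕ) (D : ℕ) (hD : ∀ I, q * u I + (q + 1) * v I ≤ D)
    (hcard : q * (D / q + 1) < Fintype.card ι) :
    ∃ b : ι → F, b ≠ 0 ∧ curvePoly q α e ∣ ∑ I, C (C (b I)) * bimon F (u I) (v I) := by
  classical
  choose g hgd hgl hw using fun I => exists_reduced_bimon_of_weight_le hq α e (hD I)
  let L : (ι → F) →ₗ[F] (Fin q × Fin (D / q + 1) → F) :=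
    LinearMap.pi fun p => ∑ I, ((g I).coeff p.1).coeff p.2 • LinearMap.proj I
  have hker : LinearMap.ker L ≠ ⊥ := LinearMap.ker_ne_bot_of_finrank_lt (by simpa using hcard)
  obtain ⟨b, hb, hb0⟩ := (Submodule.ne_bot_iff _).mp hker
  refine ⟨b, hb0, ?_⟩
  have hsum : ∑ I, C (C (b I)) * g I = 0 := by
    ext j i
    simp only [finsetSum_coeff, coeff_C_mul, coeff_zero]
    rcases lt_or_ge j q with hj | hj
    · rcases lt_or_ge i (D / q + 1) with hi | hi
      · have := congrFun (LinearMap.mem_ker.mp hb) (⟨j, hj⟩, ⟨i, hi⟩)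
        simp only [L, LinearMap.pi_apply, LinearMap.sum_apply, LinearMap.smul_apply,
          LinearMap.proj_apply, smul_eq_mul, Pi.zero_apply] at this
        rw [← this]
        exact Finset.sum_congr rfl fun I _ => mul_comm _ _
      · refine Finset.sum_eq_zero fun I _ => ?_
        rw [hw I i j, mul_zero]
        have := Nat.lt_mul_div_succ D (by omega : 0 < q)
        exact this.trans_le (Nat.mul_le_mul_left _ hi)
    · refine Finset.sum_eq_zero fun I _ => ?_
      rw [coeff_eq_zero_of_degree_lt ((hgl I).trans_le (by exact_mod_cast hj))]
      simp
  have : ∑ I, C (C (b I)) * bimon F (u I) (v I) =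
      ∑ I, C (C (b I)) * (bimon F (u I) (v I) - g I) := by
    simp only [mul_sub, Finset.sum_sub_distrib, hsum, sub_zero]
  rw [this]
  exact Finset.dvd_sum fun I _ => dvd_mul_of_dvd_right (hgd I) _

lemma evalEval_bimon (x w : F) (i j : ℕ) : evalEval x w (bimon F i j) = x ^ i * w ^ j := by
  simp [bimon, evalEval]

/-- A nonzero function on the curve of weight at most `D` vanishes on at most `D / q` complete
fibres of the projection to the `x`-line. -/
lemma card_mul_le_of_vanishing {q : ℕ} (hq : 2 ≤ q) {α e : F} {ι : Type*} [Fintype ι]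
    (u v : ι → ℕ) (D : ℕ) (hD : ∀ I, q * u I + (q + 1) * v I ≤ D) (a : ι → F)
    (hnd : ¬ curvePoly q α e ∣ ∑ I, C (C (a I)) * bimon F (u I) (v I))
    (S : Finset F)
    (hS : ∀ x ∈ S, ∃ T : Finset F, T.card = q ∧ ∀ w ∈ T,
      evalEval x w (curvePoly q α e) = 0 ∧
      evalEval x w (∑ I, C (C (a I)) * bimon F (u I) (v I)) = 0) :
    q * S.card ≤ D := by
  classical
  choose g hgd hgl hw using fun I => exists_reduced_bimon_of_weight_le hq α e (hD I)
  set G : F[X][X] := ∑ I, C (C (a I)) * g I with hG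
  have hdiff : curvePoly q α e ∣ ∑ I, C (C (a I)) * bimon F (u I) (v I) - G := by
    rw [hG, ← Finset.sum_sub_distrib]
    refine Finset.dvd_sum fun I _ => ?_
    rw [← mul_sub]
    exact dvd_mul_of_dvd_right (hgd I) _
  have hG0 : G ≠ 0 := by
    intro h
    rw [h, sub_zero] at hdiff
    exact hnd hdiff
  have hGdeg : G.degree < q := by
    rw [hG]
    simp only [← mem_degreeLT] at *
    refine sum_mem fun I _ => ?_
    rw [← smul_eq_C_mul]
    exact Submodule.smul_mem _ _ (hgl I)
  obtain ⟨j, hj⟩ : ∃ j, G.coeff j ≠ 0 := by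
    by_contra! h
    exact hG0 (Polynomial.ext (by simpa using h))
  have hnat : q * (G.coeff j).natDegree ≤ D := by
    by_contra! h
    apply hj
    rw [← leadingCoeff_eq_zero, leadingCoeff]
    simp only [hG, finsetSum_coeff, coeff_C_mul] at h ⊢
    exact Finset.sum_eq_zero fun I _ => by rw [hw I _ j h, mul_zero]
  refine le_trans (Nat.mul_le_mul_left q ?_) hnat
  by_contra! hlt
  apply hj
  refine eq_zero_of_natDegree_lt_card_of_eval_eq_zero' _ S (fun x hx => ?_) hlt
  obtain ⟨T, hTc, hT⟩ := hS x hx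
  have hmap : G.map (evalRingHom x) = 0 := by
    refine eq_zero_of_degree_lt_of_eval_finset_eq_zero T ?_ fun w hwT => ?_
    · rw [hTc]
      exact (degree_map_le).trans_lt hGdeg
    · obtain ⟨k, hk⟩ := hdiff
      obtain ⟨h1, h2⟩ := hT w hwT
      have h3 : evalEval x w G = 0 := by
        have : G = ∑ I, C (C (a I)) * bimon F (u I) (v I) - curvePoly q α e * k := by
          rw [← hk]; ring
        rw [this, evalEval_sub, h2, evalEval_mul, h1]
        simp
      rw [map_evalRingHom_eval]
      exact h3
  have := congrArg (fun f => Polynomial.coeff f j) hmap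
  simpa [coeff_map] using this

lemma evalEval_curvePoly {q : ℕ} (hq : 2 ≤ q) {α e x y : F} (hx : x ≠ 0)
    (h : y ^ q - y = x + α * x⁻¹ - e) : evalEval x (x * y) (curvePoly q α e) = 0 := by
  obtain ⟨r, rfl⟩ := Nat.exists_eq_add_of_le' hq
  have h' : y ^ (r + 2) = y + (x + α * x⁻¹ - e) := by rw [← h]; ring
  simp only [evalEval, curvePoly, eval_sub, eval_add, eval_mul, eval_pow, eval_X, eval_C,
    mul_pow, h', show r + 2 - 1 = r + 1 by omega]
  field_simp
  ring

lemma evalEval_sum_bimon {ι : Type*} [Fintype ι] (u v : ι → ℕ) (a : ι → F) (x w : F) :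
    evalEval x w (∑ I, C (C (a I)) * bimon F (u I) (v I)) =
      ∑ I, a I * (x ^ u I * w ^ v I) := by
  have : ∀ f : F[X][X], evalEval x w f = evalEvalRingHom x w f := fun f => by simp
  rw [this, map_sum]
  refine Finset.sum_congr rfl fun I _ => ?_
  rw [← this, evalEval_mul, evalEval_bimon]
  simp [evalEval]

set_option maxHeartbeats 2000000 in
/-- Stepanov's bound for the number of `x ≠ 0` such that `x + α / x - e` is of the
form `y ^ q - y`. -/
theorem stepanov_bound {K : Type*} [Field K] [Fintype K] [Fintype F] [DecidableEq F]
    (f : K →+* F) {q s : ℕ}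
    (hK : Fintype.card K = q) (hs : 4 ≤ s) (hF : Fintype.card F = (q ^ s) ^ 2) (α e : F) :
    q * (Finset.univ.filter fun x : F => x ≠ 0 ∧ ∃ y : F, y ^ q - y = x + α * x⁻¹ - e).card ≤
      (q ^ s) ^ 2 + 2 * q ^ 2 * q ^ s := by
  classical
  have hq : 2 ≤ q := hK ▸ Fintype.one_lt_card
  obtain ⟨p, hchar, k, hp, hpk⟩ := FiniteField.card' K
  have : Fact p.Prime := ⟨hp⟩
  have : CharP F p := charP_of_injective_ringHom f.injective p
  have hqp : q = p ^ (k : ℕ) := by rw [← hK, hpk]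
  have hPp : q ^ s = p ^ (k * s : ℕ) := by rw [hqp, pow_mul]
  set P := q ^ s with hP
  obtain ⟨m, rfl⟩ : ∃ m, s = m + 1 := ⟨s - 1, by omega⟩
  set P' := q ^ m with hP'
  have hPP' : P = q * P' := by rw [hP, hP', pow_succ, mul_comm]
  have hP'q : q ^ 3 ≤ P' := Nat.pow_le_pow_right (by omega) (by omega)
  have hqP' : q ≤ P' := le_trans (by nlinarith [sq_nonneg q]) hP'q
  obtain ⟨A, hA⟩ : ∃ A, P' = A + q := ⟨P' - q, by omega⟩
  let B := P' + q
  let ι := (Fin A × Fin q) × (Fin B × Fin q)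
  have hAw : ∀ c : Fin A × Fin q, q * (c.1 : ℕ) + (q + 1) * c.2 + q + 1 ≤ P := by
    intro c
    have h1 : (c.1 : ℕ) + 1 ≤ A := c.1.2
    have h2 : (c.2 : ℕ) + 1 ≤ q := c.2.2
    have h3 := Nat.mul_le_mul_left q h1
    have h4 := Nat.mul_le_mul_left (q + 1) h2
    rw [hPP', hA]
    nlinarith
  have hBw : ∀ c : Fin B × Fin q, q * (c.1 : ℕ) + (q + 1) * c.2 + q + 1 ≤ P + 2 * q ^ 2 := by
    intro c
    have h1 : (c.1 : ℕ) + 1 ≤ P' + q := c.1.2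
    have h2 : (c.2 : ℕ) + 1 ≤ q := c.2.2
    have h3 := Nat.mul_le_mul_left q h1
    have h4 := Nat.mul_le_mul_left (q + 1) h2
    rw [hPP']
    nlinarith
  have hP0 : 0 < P := by positivity
  obtain ⟨b, hb0, hb⟩ := exists_dvd_sum_bimon hq α e (ι := ι)
    (fun I => I.1.1 * P + I.2.1) (fun I => I.1.2 * P + I.2.2)
    (P * (P - q - 1) + (P + 2 * q ^ 2 - q - 1)) (by
      intro I
      have h1 : q * (I.1.1 : ℕ) + (q + 1) * I.1.2 ≤ P - q - 1 := by have := hAw I.1; omega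
      have h2 : q * (I.2.1 : ℕ) + (q + 1) * I.2.2 ≤ P + 2 * q ^ 2 - q - 1 := by
        have := hBw I.2; omega
      have h3 := Nat.mul_le_mul_left P h1
      calc _ = P * (q * (I.1.1 : ℕ) + (q + 1) * I.1.2) + (q * (I.2.1 : ℕ) + (q + 1) * I.2.2) := by
            ring
        _ ≤ _ := add_le_add h3 h2) (by
      have hPq : q + 1 ≤ P := by nlinarith
      obtain ⟨R, hR⟩ : ∃ R, P = R + (q + 1) := ⟨P - (q + 1), by omega⟩
      have e1 : P - q - 1 = R := by omega
      have e2 : P + 2 * q ^ 2 - q - 1 = R + 2 * q ^ 2 := by omega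
      rw [e1, e2]
      have h5 : q * ((P * R + (R + 2 * q ^ 2)) / q) ≤ P * R + (R + 2 * q ^ 2) := Nat.mul_div_le _ _
      have h6 : Fintype.card ι = (A * q) * ((P' + q) * q) := by simp [ι, B]
      rw [h6, mul_add]
      have h7 : q ^ 4 ≤ P := by rw [hPP']; calc q ^ 4 = q * q ^ 3 := by ring
          _ ≤ _ := Nat.mul_le_mul_left q hP'q
      have hPR : P * (R + (q + 1)) = P ^ 2 := by rw [← hR]; ring
      have hAB : (A * q) * ((P' + q) * q) + q ^ 4 = P ^ 2 := by
        rw [hPP', hA]; ring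
      have h8 : 4 ≤ q ^ 2 := by nlinarith
      have h9 : q ^ 4 + 2 * q ^ 2 ≤ 2 * q ^ 4 := by nlinarith
      have h10 : 2 * q ^ 4 ≤ q * P := Nat.mul_le_mul hq h7
      nlinarith)
  have hmain := card_mul_le_of_vanishing hq (α := α) (e := e) (ι := ι)
    (fun I => I.1.1 + I.2.1 * P) (fun I => I.1.2 + I.2.2 * P)
    ((P - q - 1) + P * (P + 2 * q ^ 2 - q - 1)) (by
      intro I
      have h1 : q * (I.1.1 : ℕ) + (q + 1) * I.1.2 ≤ P - q - 1 := by have := hAw I.1; omega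
      have h2 : q * (I.2.1 : ℕ) + (q + 1) * I.2.2 ≤ P + 2 * q ^ 2 - q - 1 := by
        have := hBw I.2; omega
      have h3 := Nat.mul_le_mul_left P h2
      calc _ = (q * (I.1.1 : ℕ) + (q + 1) * I.1.2) + P * (q * (I.2.1 : ℕ) + (q + 1) * I.2.2) := by
            ring
        _ ≤ _ := add_le_add h1 h3) (fun I => b I ^ P) (by
      intro hdvd
      have hz := eq_zero_of_dvd_sum_bimon hq _ _ ?_ _ hdvd
      · apply hb0
        funext I
        have := congrFun hz I
        simpa using eq_zero_of_pow_eq_zero this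
      · have hbox : ∀ i i' j j' : ℕ, j < q → j' < q →
            q * i + (q + 1) * j = q * i' + (q + 1) * j' → i = i' ∧ j = j' := by
          intro i i' j j' hj hj' h
          have hjj : j = j' := by
            have h1 : (j + q * (i + j)) % q = (j' + q * (i' + j')) % q := by
              congr 1; linarith
            rwa [Nat.add_mul_mod_self_left, Nat.add_mul_mod_self_left, Nat.mod_eq_of_lt hj,
              Nat.mod_eq_of_lt hj'] at h1
          subst hjj
          exact ⟨Nat.eq_of_mul_eq_mul_left (by omega : 0 < q) (by omega), rfl⟩
        rintro ⟨c, d⟩ ⟨c', d'⟩ h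
        simp only at h
        have hc := hAw c
        have hc' := hAw c'
        have hcd : (q * (c.1 : ℕ) + (q + 1) * c.2) + P * (q * (d.1 : ℕ) + (q + 1) * d.2) =
            (q * (c'.1 : ℕ) + (q + 1) * c'.2) + P * (q * (d'.1 : ℕ) + (q + 1) * d'.2) := by
          linarith
        have h1 := congrArg (· % P) hcd
        simp only [Nat.add_mul_mod_self_left] at h1
        rw [Nat.mod_eq_of_lt (by omega), Nat.mod_eq_of_lt (by omega)] at h1
        have h2 : q * (d.1 : ℕ) + (q + 1) * d.2 = q * (d'.1 : ℕ) + (q + 1) * d'.2 :=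
          Nat.eq_of_mul_eq_mul_left hP0 (by omega)
        obtain ⟨e1, e2⟩ := hbox _ _ _ _ c.2.2 c'.2.2 h1
        obtain ⟨e3, e4⟩ := hbox _ _ _ _ d.2.2 d'.2.2 h2
        ext <;> assumption)
    (Finset.univ.filter fun x : F => x ≠ 0 ∧ ∃ y : F, y ^ q - y = x + α * x⁻¹ - e) (by
      intro x hx
      simp only [Finset.mem_filter, Finset.mem_univ, true_and] at hx
      obtain ⟨hx0, y, hy⟩ := hx
      refine ⟨Finset.univ.image fun t : K => x * (y + f t), ?_, ?_⟩
      · rw [Finset.card_image_of_injective, Finset.card_univ, hK]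
        intro t t' h
        exact f.injective (add_left_cancel (mul_left_cancel₀ hx0 h))
      · intro w hw
        simp only [Finset.mem_image, Finset.mem_univ, true_and] at hw
        obtain ⟨t, rfl⟩ := hw
        have hc : evalEval x (x * (y + f t)) (curvePoly q α e) = 0 := by
          refine evalEval_curvePoly hq hx0 ?_
          have ht : (f t) ^ q = f t := by rw [← map_pow, ← hK, FiniteField.pow_card]
          rw [← hy, hqp, add_pow_char_pow, ← hqp, ht]
          ring
        refine ⟨hc, ?_⟩
        set w := x * (y + f t)
        rw [evalEval_sum_bimon]
        have h0 : ∑ I : ι,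
            b I * (x ^ ((I.1.1 : ℕ) * P + I.2.1) * w ^ ((I.1.2 : ℕ) * P + I.2.2)) = 0 := by
          rw [← evalEval_sum_bimon]
          obtain ⟨h, hh⟩ := hb
          rw [hh, evalEval_mul, hc, zero_mul]
        have hfr : ∀ z : F, z ^ (P * P) = z := by
          intro z
          have := FiniteField.pow_card z
          rwa [hF, sq] at this
        refine eq_zero_of_pow_eq_zero (n := P) ?_
        rw [← h0]
        conv_lhs => rw [hPp, sum_pow_char_pow, ← hPp]
        refine Finset.sum_congr rfl fun I _ => ?_
        rw [mul_pow, mul_pow, ← pow_mul, hfr, ← pow_mul, ← pow_mul, add_mul, add_mul, mul_assoc,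
          mul_assoc, pow_add, pow_add, pow_add, pow_add, mul_comm (I.2.1 : ℕ), mul_comm (I.2.2 : ℕ),
          pow_mul x (P * P), pow_mul w (P * P), hfr, hfr])
  refine hmain.trans ?_
  have h1 : P + 2 * q ^ 2 - q - 1 + (q + 1) = P + 2 * q ^ 2 := by
    have : q + 1 ≤ P := by nlinarith
    omega
  have h2 : P * (P + 2 * q ^ 2 - q - 1) + P * (q + 1) = P * (P + 2 * q ^ 2) := by
    rw [← mul_add, h1]
  have h3 : P * (P + 2 * q ^ 2) = P ^ 2 + 2 * q ^ 2 * P := by ring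
  have h4 : P ≤ P * (q + 1) := Nat.le_mul_of_pos_right _ (by omega)
  omega

end Curve

section CharacterSum

open scoped Classical in
/-- The Kloosterman sum `∑ ψ (x + α / x)` over the nonzero elements of a finite field. -/
noncomputable def kloosterman {F : Type*} [Field F] [Fintype F] (ψ : AddChar F ℂ) (α : F) : ℂ :=
  ∑ x : F with x ≠ 0, ψ (x + α * x⁻¹)

variable {F : Type*} [Field F] [Fintype F]

lemma card_le_mul_card_image_pow_sub [DecidableEq F] {q : ℕ} (hq : 2 ≤ q) :
    Fintype.card F ≤ q * (Finset.univ.image fun y : F => y ^ q - y).card := by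
  rw [← Finset.card_univ]
  refine Finset.card_le_mul_card_image _ _ fun c _ => ?_
  have hdeg : (X ^ q - (X + C c) : F[X]).natDegree = q := by
    rw [natDegree_sub_eq_left_of_natDegree_lt] <;> simp
    omega
  refine le_trans (card_le_degree_of_subset_roots (p := X ^ q - (X + C c)) ?_) hdeg.le
  intro y hy
  have hne : (X ^ q - (X + C c) : F[X]) ≠ 0 := by
    intro h
    rw [h] at hdeg
    simp at hdeg
    omega
  simp only [Finset.filter_val, Multiset.mem_filter, Finset.mem_val, Finset.mem_univ,
    true_and] at hy
  rw [mem_roots hne]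
  simp [← hy]

/-- A uniform bound for Kloosterman sums over large fields of square order, with square-root
cancellation but a poor constant. -/
lemma norm_kloosterman_le_of_card_eq_sq {K : Type*} [Field K] [Fintype K] (f : K →+* F) {q s : ℕ}
    (hK : Fintype.card K = q) (hs : 4 ≤ s) (hF : Fintype.card F = (q ^ s) ^ 2)
    (ψ : AddChar F ℂ) (hψ : ψ ≠ 1) (hψq : ∀ z, ψ (z ^ q) = ψ z) (α : F) :
    ‖kloosterman ψ α‖ ≤ 2 * q ^ 2 * q ^ s + 1 := by
  classical
  have hq : 2 ≤ q := hK ▸ Fintype.one_lt_card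
  set I := Finset.univ.image fun y : F => y ^ q - y with hI
  have hIcard := card_le_mul_card_image_pow_sub (F := F) hq
  rw [← hI, hF] at hIcard
  let N : F → ℕ := fun e =>
    (Finset.univ.filter fun x : F => x ≠ 0 ∧ ∃ y : F, y ^ q - y = x + α * x⁻¹ - e).card
  have hN : ∀ e, (N e : ℝ) ≤ ((q ^ s) ^ 2 + 2 * q ^ 2 * q ^ s) / q := by
    intro e
    rw [le_div_iff₀ (by positivity), mul_comm]
    exact_mod_cast stepanov_bound f hK hs hF α e
  have hcount : ∀ φ : F → ℂ, ∑ e, φ e * N e =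
      ∑ x : F with x ≠ 0, ∑ v ∈ I, φ (x + α * x⁻¹ - v) := by
    intro φ
    have h1 : ∀ e, φ e * N e =
        ∑ x : F with x ≠ 0, if x + α * x⁻¹ - e ∈ I then φ e else 0 := by
      intro e
      rw [← Finset.sum_filter, Finset.sum_const, nsmul_eq_mul, mul_comm, Finset.filter_filter]
      simp only [N, hI, Finset.mem_image, Finset.mem_univ, true_and]
    simp only [h1]
    rw [Finset.sum_comm]
    refine Finset.sum_congr rfl fun x _ => ?_
    rw [← Finset.sum_filter]
    refine Finset.sum_nbij' (fun e => x + α * x⁻¹ - e) (fun v => x + α * x⁻¹ - v) ?_ ?_ ?_ ?_ ?_ <;>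
      simp
  have hψI : ∀ v ∈ I, ψ v = 1 := by
    intro v hv
    simp only [hI, Finset.mem_image, Finset.mem_univ, true_and] at hv
    obtain ⟨y, rfl⟩ := hv
    rw [AddChar.map_sub_eq_div, hψq, div_self]
    intro h
    exact AddChar.val_isUnit ψ y |>.ne_zero h
  have hsum : ∑ e, ψ e * N e = I.card * kloosterman ψ α := by
    rw [hcount, kloosterman, Finset.mul_sum]
    refine Finset.sum_congr rfl fun x _ => ?_
    rw [Finset.sum_congr rfl (g := fun _ => ψ (x + α * x⁻¹)) fun v hv => ?_]
    · simp
    · rw [AddChar.map_sub_eq_div, hψI v hv, div_one]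
  have htot : ∑ e, (N e : ℝ) = ((q ^ s) ^ 2 - 1) * I.card := by
    have h := hcount 1
    simp only [Pi.one_apply, one_mul, Finset.sum_const, nsmul_eq_mul, mul_one] at h
    have hc : ((Finset.univ.filter fun x : F => x ≠ 0).card : ℂ) = (q ^ s) ^ 2 - 1 := by
      rw [Finset.filter_ne', Finset.card_erase_of_mem (Finset.mem_univ _), Finset.card_univ, hF,
        Nat.cast_sub (Nat.one_le_iff_ne_zero.mpr (by positivity))]
      push_cast
      ring
    rw [hc] at h
    exact_mod_cast h
  set c : ℝ := ((q ^ s) ^ 2 + 2 * q ^ 2 * q ^ s) / q with hcdef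
  have hψ0 : ∑ e, ψ e = 0 := AddChar.sum_eq_zero_of_ne_one hψ
  have hbound : (I.card : ℝ) * ‖kloosterman ψ α‖ ≤
      (q ^ s) ^ 2 * c - ((q ^ s) ^ 2 - 1) * I.card := by
    have h1 : (I.card : ℂ) * kloosterman ψ α = ∑ e, ψ e * ((N e : ℂ) - (c : ℂ)) := by
      simp only [mul_sub, Finset.sum_sub_distrib, hsum, ← Finset.sum_mul, hψ0]
      simp
    have h2 : (I.card : ℝ) * ‖kloosterman ψ α‖ = ‖(I.card : ℂ) * kloosterman ψ α‖ := by simp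
    rw [h2, h1]
    refine (norm_sum_le _ _).trans ?_
    have h3 : ∀ e, ‖ψ e * ((N e : ℂ) - (c : ℂ))‖ = c - N e := by
      intro e
      rw [norm_mul, AddChar.norm_apply, one_mul, ← Complex.ofReal_natCast, ← Complex.ofReal_sub,
        Complex.norm_real, Real.norm_of_nonpos (by linarith [hN e])]
      ring
    simp only [h3, Finset.sum_sub_distrib, htot, Finset.sum_const, Finset.card_univ, hF,
      nsmul_eq_mul]
    push_cast
    exact le_refl _
  have hIc : ((q : ℝ) ^ s) ^ 2 ≤ q * I.card := by exact_mod_cast hIcard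
  have hq0 : (0 : ℝ) < q := by positivity
  have hI0 : (0 : ℝ) < I.card := by
    have : (0 : ℝ) < ((q : ℝ) ^ s) ^ 2 := by positivity
    by_contra! h
    nlinarith
  have hcq : c * q = (q ^ s) ^ 2 + 2 * q ^ 2 * q ^ s := by
    rw [hcdef]; field_simp
  have hc0 : 0 ≤ c := by rw [hcdef]; positivity
  refine le_of_mul_le_mul_left ?_ hI0
  calc _ ≤ _ := hbound
    _ ≤ (q * I.card) * c - ((q ^ s) ^ 2 - 1) * I.card := by gcongr
    _ = I.card * (c * q - (q ^ s) ^ 2 + 1) := by ring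
    _ = _ := by rw [hcq]; ring

lemma eq_and_eq_or_of_add_eq_of_mul_eq {R : Type*} [CommRing R] [IsDomain R] {x x' y y' : R}
    (h1 : x + x' = y + y') (h2 : x * x' = y * y') : (y = x ∧ y' = x') ∨ (y = x' ∧ y' = x) := by
  have h3 : (y - x) * (y - x') = 0 := by linear_combination (-y) * h1 + h2
  rcases mul_eq_zero.mp h3 with h | h
  · exact .inl ⟨by linear_combination h, by linear_combination -h1 - h⟩
  · exact .inr ⟨by linear_combination h, by linear_combination -h1 - h⟩

lemma sum_card_fiber_mul {ι κ R : Type*} [Fintype ι] [Fintype κ] [DecidableEq κ] [Semiring R]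
    (g : ι → κ) (G : κ → R) :
    ∑ p, ((Finset.univ.filter fun x => g x = p).card : R) * G p = ∑ x, G (g x) := by
  rw [← Finset.sum_fiberwise Finset.univ g fun x => G (g x)]
  refine Finset.sum_congr rfl fun p _ => ?_
  rw [Finset.sum_congr rfl (g := fun _ => G p), Finset.sum_const, nsmul_eq_mul]
  intro x hx
  rw [(Finset.mem_filter.mp hx).2]

/-- The Kloosterman sum over a quadratic extension in terms of the one over the base field. -/
lemma kloosterman_quadratic {E : Type*} [Field E] [Fintype E] [Algebra F E]
    (hE : Module.finrank F E = 2) (ψ : AddChar F ℂ) (hψ : ψ ≠ 1) {α : F} (hα : α ≠ 0) :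
    kloosterman (ψ.compAddMonoidHom (Algebra.trace F E).toAddMonoidHom) (algebraMap F E α) =
      2 * Fintype.card F - kloosterman ψ α ^ 2 := by
  classical
  have htr : ∀ x : E, algebraMap F E (Algebra.trace F E x) = x + x ^ Fintype.card F := by
    intro x
    rw [FiniteField.algebraMap_trace_eq_sum_pow, hE]
    simp [Finset.sum_range_succ]
  have hnm : ∀ x : E, algebraMap F E (Algebra.norm F x) = x * x ^ Fintype.card F := by
    intro x
    rw [FiniteField.algebraMap_norm_eq_prod_pow, hE]
    simp [Finset.prod_range_succ]
  have hinj := (algebraMap F E).injective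
  have hfix : ∀ u : F, (algebraMap F E u) ^ Fintype.card F = algebraMap F E u := by
    intro u; rw [← map_pow, FiniteField.pow_card]
  let r₂ : F × F → Finset E := fun p =>
    Finset.univ.filter fun x => (Algebra.trace F E x, Algebra.norm F x) = p
  let r₁ : F × F → Finset (F × F) := fun p =>
    Finset.univ.filter fun w => (w.1 + w.2, w.1 * w.2) = p
  have hle : ∀ p ∈ (Finset.univ : Finset (F × F)), (r₁ p).card + (r₂ p).card ≤ 2 := by
    rintro ⟨t, n⟩ -
    by_cases h1 : (r₁ (t, n)).Nonempty
    · obtain ⟨⟨u, v⟩, huv⟩ := h1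
      simp only [r₁, Finset.mem_filter, Finset.mem_univ, true_and, Prod.mk.injEq] at huv
      obtain ⟨rfl, rfl⟩ := huv
      have s₁ : r₁ (u + v, u * v) ⊆ {(u, v), (v, u)} := by
        rintro ⟨a, b⟩ hab
        simp only [r₁, Finset.mem_filter, Finset.mem_univ, true_and, Prod.mk.injEq] at hab
        rcases eq_and_eq_or_of_add_eq_of_mul_eq hab.1.symm hab.2.symm with
          ⟨rfl, rfl⟩ | ⟨rfl, rfl⟩ <;> simp
      have s₂ : r₂ (u + v, u * v) ⊆ if u = v then {algebraMap F E u} else ∅ := by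
        intro x hx
        simp only [r₂, Finset.mem_filter, Finset.mem_univ, true_and, Prod.mk.injEq] at hx
        have ht := htr x
        have hn := hnm x
        rw [hx.1, map_add] at ht
        rw [hx.2, map_mul] at hn
        have huv : x = algebraMap F E u ∧ u = v := by
          rcases eq_and_eq_or_of_add_eq_of_mul_eq ht hn with ⟨h, h'⟩ | ⟨h, h'⟩
          · rw [h, hfix] at h'
            exact ⟨h, hinj h'⟩
          · rw [h, hfix] at h'
            exact ⟨h.trans h', (hinj h').symm⟩
        rw [if_pos huv.2, huv.1]
        simp
      by_cases huv : u = v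
      · subst huv
        have c₁ := Finset.card_le_card s₁
        have c₂ := Finset.card_le_card s₂
        simp only [Finset.pair_eq_singleton, Finset.card_singleton, if_true] at c₁ c₂
        omega
      · have c₁ := (Finset.card_le_card s₁).trans Finset.card_le_two
        have c₂ := Finset.card_le_card s₂
        rw [if_neg huv, Finset.card_empty] at c₂
        omega
    · rw [Finset.not_nonempty_iff_eq_empty] at h1
      rw [h1, Finset.card_empty, zero_add]
      by_cases h2 : (r₂ (t, n)).Nonempty
      · obtain ⟨x, hx⟩ := h2
        refine (Finset.card_le_card (t := {x, x ^ Fintype.card F}) ?_).trans Finset.card_le_two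
        intro y hy
        simp only [r₂, Finset.mem_filter, Finset.mem_univ, true_and, Prod.mk.injEq] at hx hy
        have ht := (htr x).symm.trans ((congrArg _ (hx.1.trans hy.1.symm)).trans (htr y))
        have hn := (hnm x).symm.trans ((congrArg _ (hx.2.trans hy.2.symm)).trans (hnm y))
        rcases eq_and_eq_or_of_add_eq_of_mul_eq ht hn with ⟨h, -⟩ | ⟨h, -⟩ <;> simp [h]
      · rw [Finset.not_nonempty_iff_eq_empty] at h2
        simp [h2]
  have hEcard : Fintype.card E = Fintype.card F ^ 2 := by
    rw [← hE]; exact Module.card_eq_pow_finrank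
  have heq : ∀ p : F × F, (r₁ p).card + (r₂ p).card = 2 := by
    have htotal : ∑ p : F × F, ((r₁ p).card + (r₂ p).card) = ∑ p : F × F, 2 := by
      rw [Finset.sum_add_distrib, ← Finset.card_eq_sum_card_fiberwise (by simp),
        ← Finset.card_eq_sum_card_fiberwise (by simp)]
      simp [hEcard]
      ring
    intro p
    exact (Finset.sum_eq_sum_iff_of_le hle).mp htotal p (Finset.mem_univ _)
  let G : F × F → ℂ := fun p => if p.2 = 0 then 0 else ψ (p.1 + α * (p.1 * p.2⁻¹))
  have hnorm0 : ∀ x : E, Algebra.norm F x = 0 ↔ x = 0 := fun x => Algebra.norm_eq_zero_iff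
  have hK₂ : kloosterman (ψ.compAddMonoidHom (Algebra.trace F E).toAddMonoidHom)
      (algebraMap F E α) = ∑ p, (r₂ p).card * G p := by
    rw [sum_card_fiber_mul, kloosterman, Finset.sum_filter]
    refine Finset.sum_congr rfl fun x _ => ?_
    by_cases hx : x = 0
    · simp [G, hx]
    · have hn : Algebra.norm F x ≠ 0 := fun h => hx ((hnorm0 x).mp h)
      have hinv : Algebra.trace F E x⁻¹ = Algebra.trace F E x * (Algebra.norm F x)⁻¹ := by
        apply hinj
        rw [map_mul, map_inv₀ (algebraMap F E), htr, htr, hnm]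
        have : x ^ Fintype.card F ≠ 0 := pow_ne_zero _ hx
        rw [inv_pow]
        field_simp
        ring
      have : Algebra.trace F E (algebraMap F E α * x⁻¹) = α * Algebra.trace F E x⁻¹ := by
        rw [← Algebra.smul_def, map_smul, smul_eq_mul]
      simp [G, hx, this, hinv]
  have hK₁ : kloosterman ψ α ^ 2 = ∑ p, (r₁ p).card * G p := by
    rw [sum_card_fiber_mul, kloosterman, sq, Finset.sum_filter, Finset.sum_mul_sum,
      ← Finset.univ_product_univ, Finset.sum_product]
    refine Finset.sum_congr rfl fun x _ => Finset.sum_congr rfl fun y _ => ?_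
    by_cases hx : x = 0
    · simp [G, hx]
    · by_cases hy : y = 0
      · simp [G, hy]
      · simp only [G, hx, hy, ne_eq, not_false_eq_true, if_true, mul_eq_zero, or_self, if_false]
        rw [← AddChar.map_add_eq_mul]
        congr 1
        field_simp
        ring
  have hG : ∑ p, G p = Fintype.card F := by
    rw [← Finset.univ_product_univ, Finset.sum_product_right]
    rw [Finset.sum_eq_single (-α)]
    · simp [G, hα]
      rw [Finset.sum_congr rfl (g := fun _ => (1 : ℂ))]
      · simp
      · intro t _
        rw [show t + -(α * (t * α⁻¹)) = 0 by field_simp; ring]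
        simp
    · intro n _ hn
      by_cases hn0 : n = 0
      · simp [G, hn0]
      · have hc : 1 + α * n⁻¹ ≠ 0 := by
          intro h
          apply hn
          field_simp at h
          linear_combination h
        simp only [G, hn0, if_false]
        have hne : ψ.mulShift (1 + α * n⁻¹) ≠ 1 := AddChar.IsPrimitive.of_ne_one hψ hc
        rw [← AddChar.sum_eq_zero_of_ne_one hne]
        refine Finset.sum_congr rfl fun t _ => ?_
        rw [AddChar.mulShift_apply]
        congr 1
        ring
    · simp
  rw [hK₂, hK₁, eq_sub_iff_add_eq, ← Finset.sum_add_distrib, ← hG, Finset.mul_sum]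
  refine Finset.sum_congr rfl fun p _ => ?_
  rw [← add_mul]
  congr 1
  have := heq p
  rw [add_comm] at this
  exact_mod_cast this

end CharacterSum

section Weil

variable {F : Type*} [Field F] [Fintype F]

lemma trace_pow_card {F K E : Type*} [Field F] [Field K] [Fintype K] [Field E] [Finite E]
    [Algebra F E] (f : K →+* F) (z : E) :
    Algebra.trace F E (z ^ Fintype.card K) = Algebra.trace F E z ^ Fintype.card K := by
  obtain ⟨p, _, m, hp, hcard⟩ := FiniteField.card' K
  have := Fact.mk hp
  have := charP_of_injective_ringHom f.injective p
  have := charP_of_injective_algebraMap (algebraMap F E).injective p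
  apply (algebraMap F E).injective
  rw [map_pow (algebraMap F E), FiniteField.algebraMap_trace_eq_sum_pow,
    FiniteField.algebraMap_trace_eq_sum_pow, hcard, sum_pow_char_pow]
  simp only [pow_right_comm]

lemma compAddMonoidHom_trace_ne_one {E : Type*} [Field E] [Finite E] [Algebra F E]
    {ψ : AddChar F ℂ} (hψ : ψ ≠ 1) :
    ψ.compAddMonoidHom (Algebra.trace F E).toAddMonoidHom ≠ 1 := by
  intro h
  apply hψ
  ext z
  obtain ⟨w, rfl⟩ := Algebra.trace_surjective F E z
  exact DFunLike.congr_fun h w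

lemma exists_kloosterman_quadratic {K : Type*} [Field K] [Fintype K] (f : K →+* F)
    (ψ : AddChar F ℂ) (hψ : ψ ≠ 1) (hψK : ∀ z, ψ (z ^ Fintype.card K) = ψ z)
    {α : F} (hα : α ≠ 0) :
    ∃ (E : Type) (_ : Field E) (_ : Fintype E) (_ : K →+* E) (χ : AddChar E ℂ) (β : E),
      χ ≠ 1 ∧ (∀ z, χ (z ^ Fintype.card K) = χ z) ∧ β ≠ 0 ∧
      Fintype.card E = Fintype.card F ^ 2 ∧
      kloosterman χ β = 2 * Fintype.card F - kloosterman ψ α ^ 2 := by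
  obtain ⟨p, _, -, hp, -⟩ := FiniteField.card' F
  have := Fact.mk hp
  let : Fintype (FiniteField.Extension F p 2) := Fintype.ofFinite _
  have hE : Module.finrank F (FiniteField.Extension F p 2) = 2 := FiniteField.finrank_extension ..
  refine ⟨FiniteField.Extension F p 2, inferInstance, inferInstance, (algebraMap _ _).comp f,
    ψ.compAddMonoidHom (Algebra.trace F _).toAddMonoidHom, algebraMap F _ α,
    compAddMonoidHom_trace_ne_one hψ, fun z => ?_, by simpa using hα, ?_,
    kloosterman_quadratic hE ψ hψ hα⟩
  · simp [trace_pow_card f, hψK]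
  · exact Module.card_eq_pow_finrank.trans (by rw [hE])

lemma exists_large_kloosterman {K : Type*} [Field K] [Fintype K] (f : K →+* F)
    (ψ : AddChar F ℂ) (hψ : ψ ≠ 1) (hψK : ∀ z, ψ (z ^ Fintype.card K) = ψ z)
    {α : F} (hα : α ≠ 0) {δ : ℝ} (hδ : 0 ≤ δ)
    (h : (2 + δ) * √(Fintype.card F) ≤ ‖kloosterman ψ α‖) (j : ℕ) :
    ∃ (E : Type) (_ : Field E) (_ : Fintype E) (_ : K →+* E) (χ : AddChar E ℂ) (β : E),
      χ ≠ 1 ∧ (∀ z, χ (z ^ Fintype.card K) = χ z) ∧ β ≠ 0 ∧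
      Fintype.card E = Fintype.card F ^ 2 ^ (j + 1) ∧
      (2 + 4 ^ (j + 1) * δ) * √(Fintype.card E) ≤ ‖kloosterman χ β‖ := by
  have key : ∀ (Q : ℕ) (k k' : ℂ) (ε : ℝ), 0 ≤ ε → k' = 2 * Q - k ^ 2 → (2 + ε) * √Q ≤ ‖k‖ →
      (2 + 4 * ε) * √((Q ^ 2 : ℕ) : ℝ) ≤ ‖k'‖ := by
    intro Q k k' ε hε hk' hk
    have h1 : ‖k‖ ^ 2 - 2 * Q ≤ ‖k'‖ := by
      rw [hk', norm_sub_rev, ← norm_pow]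
      simpa [-norm_pow] using norm_sub_norm_le (k ^ 2) (2 * Q)
    have h2 : ((2 + ε) * √Q) ^ 2 ≤ ‖k‖ ^ 2 := by gcongr
    rw [mul_pow, Real.sq_sqrt (by positivity)] at h2
    push_cast
    rw [Real.sqrt_sq (by positivity)]
    have : 0 ≤ ε ^ 2 * Q := by positivity
    linarith
  induction j with
  | zero =>
    obtain ⟨E, _, _, g, χ, β, h1, h2, h3, h4, h5⟩ := exists_kloosterman_quadratic f ψ hψ hψK hα
    refine ⟨E, _, _, g, χ, β, h1, h2, h3, by simpa using h4, ?_⟩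
    rw [h4]
    simpa using key _ _ _ _ hδ h5 h
  | succ j ih =>
    obtain ⟨E', _, _, g', χ', β', i1, i2, i3, i4, i5⟩ := ih
    obtain ⟨E, _, _, g, χ, β, h1, h2, h3, h4, h5⟩ := exists_kloosterman_quadratic g' χ' i1 i2 i3
    refine ⟨E, _, _, g, χ, β, h1, h2, h3, by rw [h4, i4, ← pow_mul]; rfl, ?_⟩
    rw [h4, show (4 : ℝ) ^ (j + 1 + 1) * δ = 4 * (4 ^ (j + 1) * δ) by ring]
    exact key _ _ _ _ (by positivity) h5 i5

/-- **Weil's bound** for Kloosterman sums, for characters that factor through the trace to some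
subfield. -/
theorem norm_kloosterman_le {K : Type*} [Field K] [Fintype K] (f : K →+* F)
    (ψ : AddChar F ℂ) (hψ : ψ ≠ 1) (hψK : ∀ z, ψ (z ^ Fintype.card K) = ψ z)
    {α : F} (hα : α ≠ 0) :
    ‖kloosterman ψ α‖ ≤ 2 * √(Fintype.card F) := by
  by_contra! hlt
  set q := Fintype.card K with hq
  obtain ⟨n, hn0, hn⟩ : ∃ n ≠ 0, Fintype.card F = q ^ n := by
    let := f.toAlgebra
    exact ⟨Module.finrank K F, Module.finrank_pos.ne', Module.card_eq_pow_finrank⟩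
  have hF : 0 < √(Fintype.card F) := Real.sqrt_pos.mpr (by exact_mod_cast Fintype.card_pos)
  obtain ⟨δ, hδ, hle⟩ : ∃ δ : ℝ, 0 < δ ∧ (2 + δ) * √(Fintype.card F) ≤ ‖kloosterman ψ α‖ := by
    refine ⟨‖kloosterman ψ α‖ / √(Fintype.card F) - 2, ?_, ?_⟩
    · rw [sub_pos, lt_div_iff₀ hF]
      exact hlt
    · rw [add_sub_cancel, div_mul_cancel₀ _ hF.ne']
  obtain ⟨J, hJ⟩ := pow_unbounded_of_one_lt (2 * q ^ 2 / δ) (by norm_num : (1 : ℝ) < 4)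
  obtain ⟨E, _, _, g, χ, β, h1, h2, h3, h4, h5⟩ :=
    exists_large_kloosterman f ψ hψ hψK hα hδ.le hle (J + 2)
  have hs : 4 ≤ n * 2 ^ (J + 2) := by
    have : 1 ≤ n * 2 ^ J := Nat.one_le_iff_ne_zero.mpr (by positivity)
    rw [pow_add, ← mul_assoc]
    omega
  have hE : Fintype.card E = (q ^ (n * 2 ^ (J + 2))) ^ 2 := by
    rw [h4, hn, ← pow_mul, ← pow_mul, pow_succ 2 (J + 2), mul_assoc]
  have h6 := norm_kloosterman_le_of_card_eq_sq g hq.symm hs hE χ h1 h2 β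
  rw [hE] at h5
  push_cast at h5
  rw [Real.sqrt_sq (by positivity)] at h5
  have hP : (1 : ℝ) ≤ (q : ℝ) ^ (n * 2 ^ (J + 2)) := by
    apply one_le_pow₀
    exact_mod_cast Fintype.card_pos (α := K)
  have h7 : 2 * (q : ℝ) ^ 2 < 4 ^ (J + 2 + 1) * δ := by
    rw [div_lt_iff₀ hδ] at hJ
    refine hJ.trans_le ?_
    gcongr
    · norm_num
    · omega
  nlinarith

end Weil

section Counting

variable {F : Type*} [Field F] [Fintype F]

open scoped Classical in
lemma sum_ne_zero_addChar_mul {χ : AddChar F ℂ} (hχ : χ ≠ 1) {c : F} (hc : c ≠ 0) :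
    ∑ x : F with x ≠ 0, χ (c * x) = -1 := by
  have h : ∑ x, χ.mulShift c x = 0 :=
    AddChar.sum_eq_zero_of_ne_one (AddChar.IsPrimitive.of_ne_one hχ hc)
  rw [Finset.filter_ne', eq_neg_iff_add_eq_zero, ← h,
    ← Finset.sum_erase_add _ _ (Finset.mem_univ (0 : F))]
  simp

open scoped Classical in
lemma sum_ne_zero_addChar_mul_inv {χ : AddChar F ℂ} (hχ : χ ≠ 1) {c : F} (hc : c ≠ 0) :
    ∑ x : F with x ≠ 0, χ (c * x⁻¹) = -1 := by
  rw [← sum_ne_zero_addChar_mul hχ hc]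
  exact Finset.sum_nbij' (·⁻¹) (·⁻¹) (by simp) (by simp) (by simp) (by simp) (by simp)

open scoped Classical in
lemma sum_ne_zero_addChar_mul_add_mul_inv (χ : AddChar F ℂ) {c : F} (hc : c ≠ 0) (d : F) :
    ∑ x : F with x ≠ 0, χ (c * x + d * x⁻¹) = kloosterman χ (c * d) := by
  rw [kloosterman]
  refine Finset.sum_nbij' (c * ·) (c⁻¹ * ·) (by simp [hc]) (by simp [hc]) (by simp [hc])
    (by simp [hc]) fun x hx => ?_
  congr 2
  rw [mul_inv]
  field_simp

open scoped Classical in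
/-- If `α` is not a product of elements with traces `a` and `b`, then a sum of twisted Kloosterman
sums vanishes, and Weil's bound limits the size of the field. -/
lemma card_sub_one_le_of_forall_trace_ne {K L : Type*} [Field K] [Field L] [Algebra K L]
    [Fintype K] [Fintype L] {α : L} (hα : α ≠ 0) (a b : K)
    (h : ∀ x ≠ 0, Algebra.trace K L x = a → Algebra.trace K L (α * x⁻¹) ≠ b) :
    (Fintype.card L : ℝ) - 1 ≤ 2 * (Fintype.card K - 1) +
      2 * (Fintype.card K - 1) ^ 2 * √(Fintype.card L) := by
  obtain ⟨ψ, hψ⟩ : ∃ ψ : AddChar K ℂ, ψ ≠ 1 := by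
    obtain ⟨ψ, hψ⟩ := AddChar.exists_apply_ne_zero.mpr (one_ne_zero (α := K))
    exact ⟨ψ, fun h => hψ (by simp [h])⟩
  set χ := ψ.compAddMonoidHom (Algebra.trace K L).toAddMonoidHom with hχdef
  have hχ : χ ≠ 1 := compAddMonoidHom_trace_ne_one hψ
  have hχK : ∀ z, χ (z ^ Fintype.card K) = χ z := fun z => by
    simp [hχdef, trace_pow_card (RingHom.id K), FiniteField.pow_card]
  let S : K → K → ℂ := fun u v => ∑ x : L with x ≠ 0,
    ψ (u * (Algebra.trace K L x - a)) * ψ (v * (Algebra.trace K L (α * x⁻¹) - b))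
  have hS : ∀ u v, ‖S u v‖ = ‖∑ x : L with x ≠ 0,
      χ (algebraMap K L u * x + algebraMap K L v * α * x⁻¹)‖ := by
    intro u v
    have hmul := norm_mul (ψ (-(u * a + v * b))) (∑ x : L with x ≠ 0,
      χ (algebraMap K L u * x + algebraMap K L v * α * x⁻¹))
    rw [AddChar.norm_apply, one_mul] at hmul
    rw [← hmul, Finset.mul_sum]
    congr 1
    refine Finset.sum_congr rfl fun x _ => ?_
    rw [mul_assoc, ← Algebra.smul_def, ← Algebra.smul_def, hχdef, ← AddChar.map_add_eq_mul,
      AddChar.compAddMonoidHom_apply, ← AddChar.map_add_eq_mul]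
    congr 1
    simp
    ring
  have hS00 : ‖S 0 0‖ = Fintype.card L - 1 := by
    simp only [S, zero_mul, AddChar.map_zero_eq_one, mul_one, Finset.sum_const, nsmul_eq_mul,
      Complex.norm_natCast]
    rw [Finset.filter_ne', Finset.card_erase_of_mem (Finset.mem_univ _), Finset.card_univ,
      Nat.cast_sub Fintype.card_pos, Nat.cast_one]
  have hSu : ∀ u ≠ 0, ‖S u 0‖ ≤ 1 := by
    intro u hu
    simp [hS, sum_ne_zero_addChar_mul hχ (show algebraMap K L u ≠ 0 by simpa)]
  have hSv : ∀ v ≠ 0, ‖S 0 v‖ ≤ 1 := by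
    intro v hv
    simp [hS, sum_ne_zero_addChar_mul_inv hχ (show algebraMap K L v * α ≠ 0 by simp [hα, hv])]
  have hSuv : ∀ u ≠ 0, ∀ v ≠ 0, ‖S u v‖ ≤ 2 * √(Fintype.card L) := by
    intro u hu v hv
    rw [hS, sum_ne_zero_addChar_mul_add_mul_inv χ (by simpa)]
    exact norm_kloosterman_le (algebraMap K L) χ hχ hχK (by simp [hα, hu, hv])
  have hsum : ∑ u, ∑ v, S u v = 0 := by
    have hprim : ψ.IsPrimitive := AddChar.IsPrimitive.of_ne_one hψ
    have : ∑ u, ∑ v, S u v = ∑ x : L with x ≠ 0, (∑ u, ψ (u * (Algebra.trace K L x - a))) *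
        ∑ v, ψ (v * (Algebra.trace K L (α * x⁻¹) - b)) := by
      simp only [Finset.sum_mul_sum, S]
      symm
      rw [Finset.sum_comm]
      refine Finset.sum_congr rfl fun u _ => ?_
      rw [Finset.sum_comm]
    rw [this]
    refine Finset.sum_eq_zero fun x hx => ?_
    rw [AddChar.sum_mulShift _ hprim, AddChar.sum_mulShift _ hprim]
    by_cases hxa : Algebra.trace K L x = a
    · simp [sub_ne_zero.mpr (h x (by simpa using hx) hxa)]
    · simp [sub_ne_zero.mpr hxa]
  have hcard : (((Finset.univ : Finset K).erase 0).card : ℝ) = Fintype.card K - 1 := by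
    rw [Finset.card_erase_of_mem (Finset.mem_univ _), Finset.card_univ,
      Nat.cast_sub Fintype.card_pos, Nat.cast_one]
  have hsplit : ∀ g : K → ℂ, ∑ v, g v = g 0 + ∑ v ∈ Finset.univ.erase 0, g v := fun g =>
    (Finset.add_sum_erase _ _ (Finset.mem_univ 0)).symm
  rw [hsplit, hsplit, add_assoc, add_eq_zero_iff_eq_neg] at hsum
  rw [← hS00, hsum, norm_neg]
  have hrow : ∀ u ∈ Finset.univ.erase (0 : K), ‖∑ v, S u v‖ ≤
      1 + (Fintype.card K - 1) * (2 * √(Fintype.card L)) := by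
    intro u hu
    have hu := (Finset.mem_erase.mp hu).1
    rw [hsplit]
    refine (norm_add_le _ _).trans (add_le_add (hSu u hu) ?_)
    refine (norm_sum_le_of_le _ fun v hv => hSuv u hu v (Finset.mem_erase.mp hv).1).trans_eq ?_
    rw [Finset.sum_const, nsmul_eq_mul, hcard]
  have h1 := norm_sum_le_of_le _ fun v (hv : v ∈ Finset.univ.erase (0 : K)) =>
    hSv v (Finset.mem_erase.mp hv).1
  have h2 := norm_sum_le_of_le _ hrow
  rw [Finset.sum_const, nsmul_eq_mul, hcard] at h1 h2
  refine (norm_add_le _ _).trans ((add_le_add h1 h2).trans_eq ?_)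
  ring

lemma two_mul_sub_one_add_lt_pow_sub_one {q n : ℕ} (hq : 2 ≤ q)
    (hn : 5 ≤ n ∨ (n = 4 ∧ (q = 2 ∨ q = 3))) :
    2 * ((q : ℝ) - 1) + 2 * (q - 1) ^ 2 * √((q ^ n : ℕ) : ℝ) < ((q ^ n : ℕ) : ℝ) - 1 := by
  rcases hn with hn | ⟨rfl, rfl | rfl⟩
  · set D := √((q ^ n : ℕ) : ℝ) with hD
    have hD2 : D ^ 2 = ((q ^ n : ℕ) : ℝ) := Real.sq_sqrt (by positivity)
    have hD0 : 0 ≤ D := Real.sqrt_nonneg _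
    have h5 : (q : ℝ) ^ 5 ≤ D ^ 2 := by
      rw [hD2]
      exact_mod_cast Nat.pow_le_pow_right (by omega) hn
    obtain ⟨t, rfl⟩ := Nat.exists_eq_add_of_le' hq
    rw [← hD2]
    push_cast at h5 ⊢
    have ht : (0 : ℝ) ≤ t := t.cast_nonneg
    have h1 : 2 * ((t : ℝ) + 2 - 1) ^ 2 + 1 ≤ D := by
      refine le_of_pow_le_pow_left₀ two_ne_zero hD0 (h5.trans' ?_)
      have : 0 ≤ (t : ℝ) ^ 5 + 6 * t ^ 4 + 24 * t ^ 3 + 52 * t ^ 2 + 56 * t + 23 := by positivity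
      linarith
    have h2 : 2 * ((t : ℝ) + 2) - 1 < D := by
      refine lt_of_pow_lt_pow_left₀ 2 hD0 (h5.trans_lt' ?_)
      have : 0 ≤ (t : ℝ) ^ 5 + 10 * t ^ 4 + 40 * t ^ 3 + 76 * t ^ 2 + 68 * t := by positivity
      linarith
    nlinarith [mul_nonneg hD0 (sub_nonneg.mpr h1)]
  · rw [show ((2 ^ 4 : ℕ) : ℝ) = 4 ^ 2 by norm_num, Real.sqrt_sq (by norm_num)]
    norm_num
  · rw [show ((3 ^ 4 : ℕ) : ℝ) = 9 ^ 2 by norm_num, Real.sqrt_sq (by norm_num)]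
    norm_num

end Counting

end KloostermanStepanov

/-- Main theorem: for F_{q^n}/F_q with n ≥ 5, or n = 4 and q ∈ {2,3}, every nonzero
α ∈ F_{q^n} is a product x·y with Tr(x) = a and Tr(y) = b, for any a, b ∈ F_q. -/
theorem stmt_17 (q n : ℕ) (hq : IsPrimePow q)
    (hn : 5 ≤ n ∨ (n = 4 ∧ (q = 2 ∨ q = 3)))
    (K L : Type*) [Field K] [Field L] [Algebra K L] [Fintype K] [Fintype L]
    (hcard : Fintype.card K = q) (hrank : Module.finrank K L = n)
    (α : L) (hα : α ≠ 0) (a b : K) :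
    ∃ x y : L, Algebra.trace K L x = a ∧ Algebra.trace K L y = b ∧ α = x * y := by
  by_contra! hcon
  have hL : Fintype.card L = q ^ n := by
    rw [← hcard, ← hrank]
    exact Module.card_eq_pow_finrank
  have hle := KloostermanStepanov.card_sub_one_le_of_forall_trace_ne hα a b fun x hx hxa hxb =>
    hcon x (α * x⁻¹) hxa hxb (by field_simp)
  rw [hL, hcard] at hle
  exact hle.not_gt (KloostermanStepanov.two_mul_sub_one_add_lt_pow_sub_one hq.two_le hn)
end
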